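/- Let I ≠ {0} be a closed ideal of A⁺ and let f ∈ A⁺ ∩ S_I·H^∞ be nonzero. If in addition f vanishes on h(I) ∩ Γ, then h(I(f)) is a perfect subset of Γ. -/

import Mathlib

noncomputable section

/-- An invertible contraction on a (complex) Banach space. -/
structure BanachContraction where
  X : Type
  [grp : NormedAddCommGroup X]
  [mod : NormedSpace ℂ X]
  [cpl : CompleteSpace X]
  T : X →L[ℂ] X
  Tinv : X →L[ℂ] X
  norm_le : ‖T‖ ≤ 1
  mul_inv : T * Tinv = 1
  inv_mul : Tinv * T = 1

attribute [instance] BanachContraction.grp BanachContraction.mod BanachContraction.cpl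

open Complex MeasureTheory Metric Set Filter

/-- The `n`-th Taylor coefficient of `f` at `0`, i.e. `f⁽ⁿ⁾(0)/n!`. -/
def taylorCoeff (f : ℂ → ℂ) (n : ℕ) : ℂ := iteratedDeriv n f 0 / (n.factorial : ℂ)

/-- `A⁺`, the algebra of absolutely convergent Taylor series: functions which, on the
closed unit disk, are sums of a power series with absolutely summable coefficients. -/
def APlus : Set (ℂ → ℂ) :=
  {f | ∃ a : ℕ → ℂ, Summable (fun n => ‖a n‖) ∧
    ∀ z ∈ Metric.closedBall (0 : ℂ) 1, HasSum (fun n => a n * z ^ n) (f z)}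

/-- The norm `‖f‖₁ = ∑ₙ |f⁽ⁿ⁾(0)/n!|` on `A⁺`. -/
def APlusNorm (f : ℂ → ℂ) : ℝ := ∑' n : ℕ, ‖taylorCoeff f n‖

/-- The `n`-th Fourier coefficient of (the boundary values of) `f` on the unit circle. -/
def fcoeff (f : ℂ → ℂ) (n : ℤ) : ℂ :=
  (1 / (2 * Real.pi)) * ∫ θ in (0:ℝ)..(2 * Real.pi),
    f (Complex.exp ((θ : ℂ) * Complex.I)) * Complex.exp (-(n : ℂ) * (θ : ℂ) * Complex.I)

/-- The Wiener algebra `A(Γ)` of absolutely convergent Fourier series on the unit circle,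
viewed as functions `ℂ → ℂ` (only the values on the unit circle are relevant). -/
def WienerAlg : Set (ℂ → ℂ) :=
  {f | Summable (fun n : ℤ => ‖fcoeff f n‖) ∧
    ∀ z ∈ Metric.sphere (0 : ℂ) 1, HasSum (fun n : ℤ => fcoeff f n * z ^ n) (f z)}

/-- The norm `‖f‖₁ = ∑_{n ∈ ℤ} |f̂(n)|` on `A(Γ)`. -/
def WienerNorm (f : ℂ → ℂ) : ℝ := ∑' n : ℤ, ‖fcoeff f n‖

/-- `I` is a closed ideal of `A⁺` (closedness w.r.t. the norm `APlusNorm`). -/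
def IsClosedIdealAPlus (I : Set (ℂ → ℂ)) : Prop :=
  I ⊆ APlus ∧
  (∀ f ∈ I, ∀ g ∈ I, f + g ∈ I) ∧
  (∀ f ∈ APlus, ∀ g ∈ I, f * g ∈ I) ∧
  (∀ f ∈ APlus, (∀ ε > 0, ∃ g ∈ I, APlusNorm (f - g) < ε) → f ∈ I)

/-- `J` is a closed ideal of the Wiener algebra `A(Γ)`. -/
def IsClosedIdealW (J : Set (ℂ → ℂ)) : Prop :=
  J ⊆ WienerAlg ∧
  (∀ f ∈ J, ∀ g ∈ J, f + g ∈ J) ∧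
  (∀ f ∈ WienerAlg, ∀ g ∈ J, f * g ∈ J) ∧
  (∀ f ∈ WienerAlg, (∀ ε > 0, ∃ g ∈ J, WienerNorm (f - g) < ε) → f ∈ J)

/-- `I^A` : the closed ideal generated by `I` in the Wiener algebra `A(Γ)`. -/
def IdealGenW (I : Set (ℂ → ℂ)) : Set (ℂ → ℂ) := ⋂₀ {J | IsClosedIdealW J ∧ I ⊆ J}

/-- The hull `h(I)`: common zeros in the closed unit disk of all elements of `I`. -/
def hull (I : Set (ℂ → ℂ)) : Set ℂ :=
  {z ∈ Metric.closedBall (0 : ℂ) 1 | ∀ f ∈ I, f z = 0}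

/-- `I ≠ {0}`: `I` contains an element not identically zero on the unit disk. -/
def NontrivialIdeal (I : Set (ℂ → ℂ)) : Prop :=
  ∃ f ∈ I, ∃ z ∈ Metric.ball (0 : ℂ) 1, f z ≠ 0

/-- `H^∞(D)`: bounded holomorphic functions on the open unit disk. -/
def Hinf : Set (ℂ → ℂ) :=
  {f | DifferentiableOn ℂ f (Metric.ball (0 : ℂ) 1) ∧
    ∃ C : ℝ, ∀ z ∈ Metric.ball (0 : ℂ) 1, ‖f z‖ ≤ C}

/-- An inner function: a bounded-by-one holomorphic function on the unit disk whose
radial limits have modulus `1` at almost every boundary point. -/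
def IsInnerFunction (u : ℂ → ℂ) : Prop :=
  DifferentiableOn ℂ u (Metric.ball (0 : ℂ) 1) ∧
  (∀ z ∈ Metric.ball (0 : ℂ) 1, ‖u z‖ ≤ 1) ∧
  ∀ᵐ (θ : ℝ) ∂(MeasureTheory.volume.restrict (Set.Ioc (0 : ℝ) (2 * Real.pi))),
    Filter.Tendsto (fun r : ℝ => ‖u ((r : ℂ) * Complex.exp ((θ : ℂ) * Complex.I))‖)
      (nhdsWithin 1 (Set.Iio 1)) (nhds 1)

/-- `S` divides (the inner factor of) `f`, i.e. `f ∈ S·H^∞`. -/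
def InnerDivides (S f : ℂ → ℂ) : Prop :=
  ∃ g ∈ Hinf, ∀ z ∈ Metric.ball (0 : ℂ) 1, f z = S z * g z

/-- `S` is a greatest common divisor of the inner factors of the nonzero elements of `I`:
`S` is inner, divides every nonzero element of `I`, and every inner function with this
property divides `S`. -/
def IsGcdInner (I : Set (ℂ → ℂ)) (S : ℂ → ℂ) : Prop :=
  IsInnerFunction S ∧
  (∀ f ∈ I, (∃ z ∈ Metric.ball (0 : ℂ) 1, f z ≠ 0) → InnerDivides S f) ∧
  ∀ S' : ℂ → ℂ, IsInnerFunction S' →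
    (∀ f ∈ I, (∃ z ∈ Metric.ball (0 : ℂ) 1, f z ≠ 0) → InnerDivides S' f) →
    InnerDivides S' S

/-- The perfect symmetric set `E_ξ` of constant ratio `ξ` on the unit circle. -/
def Eset (ξ : ℝ) : Set ℂ :=
  {z | ∃ ε : ℕ → ℕ, (∀ k, ε k ≤ 1) ∧
    z = Complex.exp (2 * Real.pi * Complex.I *
      (((1 - ξ) * ∑' k : ℕ, (ε k : ℝ) * ξ ^ k : ℝ) : ℂ))}

/-- A Carleson set: a closed subset of the unit circle with
`∫_{-π}^{π} log (2 / dist(e^{iθ}, E)) dθ < ∞`. -/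
def IsCarleson (E : Set ℂ) : Prop :=
  IsClosed E ∧ E ⊆ Metric.sphere (0 : ℂ) 1 ∧
  MeasureTheory.IntegrableOn
    (fun θ : ℝ => Real.log (2 / Metric.infDist (Complex.exp ((θ : ℂ) * Complex.I)) E))
    (Set.Ioc (-Real.pi) Real.pi)

/-- The division ideal `I(f) = {g ∈ A⁺ : fg ∈ I}`. -/
def Idiv (I : Set (ℂ → ℂ)) (f : ℂ → ℂ) : Set (ℂ → ℂ) := {g ∈ APlus | f * g ∈ I}

/-- `f` belongs to `A^∞(D)` and vanishes on `E` together with all its derivatives: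
`f` is holomorphic on the disk, and each derivative extends continuously to the closed
disk with the extension vanishing on `E`. -/
def VanishAllDeriv (E : Set ℂ) (f : ℂ → ℂ) : Prop :=
  ContinuousOn f (Metric.closedBall (0 : ℂ) 1) ∧
  DifferentiableOn ℂ f (Metric.ball (0 : ℂ) 1) ∧
  (∀ z ∈ E, f z = 0) ∧
  ∀ n : ℕ, ∃ g : ℂ → ℂ, ContinuousOn g (Metric.closedBall (0 : ℂ) 1) ∧
    Set.EqOn g (iteratedDeriv n f) (Metric.ball (0 : ℂ) 1) ∧ ∀ z ∈ E, g z = 0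

/-- `J₀⁺(E)`: the closure in `A⁺` of the set of elements of `A^∞(D)` vanishing on `E`
together with all their derivatives. -/
def J0Plus (E : Set ℂ) : Set (ℂ → ℂ) :=
  {f | f ∈ APlus ∧ ∀ ε > 0, ∃ g ∈ APlus, VanishAllDeriv E g ∧ APlusNorm (f - g) < ε}

/-- `I⁺(E) = {f ∈ A⁺ : f ≡ 0 on E}`. -/
def IPlus (E : Set ℂ) : Set (ℂ → ℂ) := {f ∈ APlus | ∀ z ∈ E, f z = 0}

/-- The pairing of `f ∈ A⁺ ≅ ℓ¹(ℕ)` with an element `c ∈ c₀`. -/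
def pairing (f : ℂ → ℂ) (c : ℕ → ℂ) : ℂ := ∑' n : ℕ, taylorCoeff f n * c n

/-- `S` is dense in `A⁺` for the weak-star topology `σ(ℓ¹, c₀)`. -/
def WStarDense (S : Set (ℂ → ℂ)) : Prop :=
  ∀ f ∈ APlus, ∀ (m : ℕ) (c : Fin m → ℕ → ℂ),
    (∀ i, Filter.Tendsto (c i) Filter.atTop (nhds 0)) →
    ∀ ε > 0, ∃ g ∈ S, ∀ i, ‖pairing f (c i) - pairing g (c i)‖ < ε

/-- `S` is closed in `A⁺` for the weak-star topology `σ(ℓ¹, c₀)`. -/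
def WStarClosed (S : Set (ℂ → ℂ)) : Prop :=
  S ⊆ APlus ∧
  ∀ f ∈ APlus,
    (∀ (m : ℕ) (c : Fin m → ℕ → ℂ),
      (∀ i, Filter.Tendsto (c i) Filter.atTop (nhds 0)) →
      ∀ ε > 0, ∃ g ∈ S, ∀ i, ‖pairing f (c i) - pairing g (c i)‖ < ε) → f ∈ S

/-- A Kronecker set: a compact subset of the unit circle on which every continuous
unimodular function is a uniform limit of characters `z ↦ zⁿ`, `n ∈ ℤ`. -/
def IsKronecker (K : Set ℂ) : Prop :=
  IsCompact K ∧ K ⊆ Metric.sphere (0 : ℂ) 1 ∧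
  ∀ f : ℂ → ℂ, ContinuousOn f K → (∀ z ∈ K, ‖f z‖ = 1) →
    ∀ ε > 0, ∃ n : ℤ, ∀ z ∈ K, ‖f z - z ^ n‖ < ε

/-- A Helson set: a compact subset of the unit circle on which every continuous function
is the restriction of an element of the Wiener algebra. -/
def IsHelson (K : Set ℂ) : Prop :=
  IsCompact K ∧ K ⊆ Metric.sphere (0 : ℂ) 1 ∧
  ∀ f : ℂ → ℂ, ContinuousOn f K → ∃ g ∈ WienerAlg, ∀ z ∈ K, f z = g z

/-- The little Lipschitz class `Λ_α(D)`: disc-algebra functions with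
`|f(e^{it₁}) - f(e^{it₂})| / |t₁-t₂|^α → 0` uniformly as `|t₁-t₂| → 0`. -/
def LittleLip (α : ℝ) (f : ℂ → ℂ) : Prop :=
  ContinuousOn f (Metric.closedBall (0 : ℂ) 1) ∧
  DifferentiableOn ℂ f (Metric.ball (0 : ℂ) 1) ∧
  ∀ ε > 0, ∃ δ > 0, ∀ t₁ t₂ : ℝ, t₁ ≠ t₂ → |t₁ - t₂| < δ →
    ‖f (Complex.exp ((t₁ : ℂ) * Complex.I)) - f (Complex.exp ((t₂ : ℂ) * Complex.I))‖ ≤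
      ε * |t₁ - t₂| ^ α

/-- The perfect part of a set: the union of all its perfect subsets. -/
def perfectPart (C : Set ℂ) : Set ℂ := ⋃₀ {P | Perfect P ∧ P ⊆ C}

/-- A distribution on the unit circle, encoded by its sequence of Fourier coefficients
`μ̂(n) = μ(e^{-int})`, which has polynomial growth. -/
structure CircleDistribution where
  coeff : ℤ → ℂ
  growth : ∃ (C : ℝ) (k : ℕ), ∀ n : ℤ, ‖coeff n‖ ≤ C * (1 + (n.natAbs : ℝ)) ^ k

/-- A smooth `2π`-periodic function (test function on the circle). -/
def PeriodicSmooth (φ : ℝ → ℂ) : Prop :=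
  ContDiff ℝ (⊤ : ℕ∞) φ ∧ ∀ θ : ℝ, φ (θ + 2 * Real.pi) = φ θ

/-- Fourier coefficients of a test function. -/
def testCoeff (φ : ℝ → ℂ) (n : ℤ) : ℂ :=
  (1 / (2 * Real.pi)) * ∫ θ in (0:ℝ)..(2 * Real.pi),
    φ θ * Complex.exp (-(n : ℂ) * (θ : ℂ) * Complex.I)

/-- The action of a distribution on a test function: `μ(φ) = ∑ₙ μ̂(n) φ̂(-n)`. -/
def distAct (μ : CircleDistribution) (φ : ℝ → ℂ) : ℂ := ∑' n : ℤ, μ.coeff n * testCoeff φ (-n)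

/-- The support of a distribution on the circle: the points of the circle having no open
neighbourhood `U` such that `μ` kills every test function supported in `U`. -/
def distSupport (μ : CircleDistribution) : Set ℂ :=
  {z ∈ Metric.sphere (0 : ℂ) 1 | ∀ U : Set ℂ, IsOpen U → z ∈ U →
    ∃ φ : ℝ → ℂ, PeriodicSmooth φ ∧
      (∀ θ : ℝ, Complex.exp ((θ : ℂ) * Complex.I) ∉ U → φ θ = 0) ∧ distAct μ φ ≠ 0}

/-- A set of multiplicity: a closed subset of the circle supporting a nonzero
pseudofunction (distribution whose Fourier coefficients tend to `0` as `|n| → ∞`). -/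
def IsMSet (E : Set ℂ) : Prop :=
  IsClosed E ∧ E ⊆ Metric.sphere (0 : ℂ) 1 ∧
  ∃ μ : CircleDistribution, μ.coeff ≠ 0 ∧ distSupport μ ⊆ E ∧
    Filter.Tendsto μ.coeff Filter.cofinite (nhds 0)

/-- A Dirichlet set: `sup_{z ∈ E} |z^{n_k} - 1| → 0` for some sequence `n_k → ∞`. -/
def IsDirichletSet (E : Set ℂ) : Prop :=
  ∃ n : ℕ → ℕ, Filter.Tendsto n Filter.atTop Filter.atTop ∧
    ∀ ε > 0, ∀ᶠ k in Filter.atTop, ∀ z ∈ E, ‖z ^ (n k) - 1‖ < ε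

theorem norm_dslope_mul_le_of_zero {G : ℂ → ℂ} {M : ℝ} {a z : ℂ}
    (hG : DifferentiableOn ℂ G (ball 0 1)) (hM : ∀ z ∈ ball (0 : ℂ) 1, ‖G z‖ ≤ M)
    (ha : a ∈ ball (0 : ℂ) 1) (hGa : G a = 0) (hz : z ∈ ball (0 : ℂ) 1) :
    ‖dslope G a z * (1 - (starRingEnd ℂ) a * z)‖ ≤ M := by
  have hne : ∀ u v : ℂ, u ∈ ball (0 : ℂ) 1 → v ∈ ball (0 : ℂ) 1 →
      1 - (starRingEnd ℂ) u * v ≠ 0 := by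
    intro u v hu hv h
    rw [mem_ball_zero_iff] at hu hv
    have h1 : (starRingEnd ℂ) u * v = 1 := (sub_eq_zero.mp h).symm
    have h2 : ‖u‖ * ‖v‖ = 1 := by
      have := congrArg norm h1
      rwa [norm_mul, RCLike.norm_conj, norm_one] at this
    nlinarith [norm_nonneg u, norm_nonneg v]
  have hmob : ∀ u v : ℂ, u ∈ ball (0 : ℂ) 1 → v ∈ ball (0 : ℂ) 1 →
      (v - u) / (1 - (starRingEnd ℂ) u * v) ∈ ball (0 : ℂ) 1 := by
    intro u v hu hv
    have h0 := hne u v hu hv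
    rw [mem_ball_zero_iff] at hu hv ⊢
    rw [norm_div, div_lt_one (norm_pos_iff.mpr h0)]
    apply lt_of_pow_lt_pow_left₀ 2 (norm_nonneg _)
    have hu2 : u.re ^ 2 + u.im ^ 2 < 1 := by
      have : ‖u‖ ^ 2 < 1 := by nlinarith [norm_nonneg u]
      rwa [← normSq_eq_norm_sq, normSq_apply, ← sq, ← sq] at this
    have hv2 : v.re ^ 2 + v.im ^ 2 < 1 := by
      have : ‖v‖ ^ 2 < 1 := by nlinarith [norm_nonneg v]
      rwa [← normSq_eq_norm_sq, normSq_apply, ← sq, ← sq] at this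
    rw [← normSq_eq_norm_sq, ← normSq_eq_norm_sq, normSq_apply, normSq_apply]
    simp
    nlinarith [mul_pos (sub_pos.mpr hu2) (sub_pos.mpr hv2)]
  have hoff : ∀ z ∈ ball (0 : ℂ) 1, z ≠ a →
      ‖dslope G a z * (1 - (starRingEnd ℂ) a * z)‖ ≤ M := by
    intro z hz hza
    have hna : -a ∈ ball (0 : ℂ) 1 := by simpa using ha
    let ψ : ℂ → ℂ := fun u => (u - (-a)) / (1 - (starRingEnd ℂ) (-a) * u)
    have hψ : DifferentiableOn ℂ ψ (ball 0 1) := by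
      intro u hu
      have := hne _ _ hna hu
      apply DifferentiableAt.differentiableWithinAt
      fun_prop (disch := assumption)
    have hmaps : MapsTo ψ (ball 0 1) (ball 0 1) := fun u hu => hmob _ _ hna hu
    have hH : DifferentiableOn ℂ (G ∘ ψ) (ball 0 1) := hG.comp hψ hmaps
    have h0 : (G ∘ ψ) 0 = 0 := by simp [ψ, hGa]
    set u := (z - a) / (1 - (starRingEnd ℂ) a * z) with hu
    have hu1 : u ∈ ball (0 : ℂ) 1 := hmob _ _ ha hz
    have hzne := hne _ _ ha hz
    have hψu : ψ u = z := by
      have h1 := hne _ _ hna hu1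
      have h2 : u * (1 - (starRingEnd ℂ) a * z) = z - a := div_mul_cancel₀ _ hzne
      simp only [ψ]
      rw [div_eq_iff h1, map_neg]
      linear_combination h2
    have hS := norm_dslope_le_div_of_mapsTo_ball (R₂ := M) hH
      (by rw [h0]; intro u hu; simpa using hM _ (hmaps hu)) hu1
    have hu0 : u ≠ 0 := div_ne_zero (sub_ne_zero.mpr hza) hzne
    rw [dslope_of_ne _ hu0, slope_def_field, h0, Function.comp, hψu] at hS
    rw [dslope_of_ne _ hza, slope_def_field, hGa]
    rw [sub_zero, sub_zero, div_one, hu] at hS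
    rw [sub_zero]
    rwa [div_div_eq_mul_div, ← div_mul_eq_mul_div] at hS
  by_cases hza : z = a
  · subst hza
    have hc : ContinuousAt (fun w => ‖dslope G z w * (1 - (starRingEnd ℂ) z * w)‖) z := by
      have h1 : ContinuousAt (dslope G z) z := by
        rw [continuousAt_dslope_same]
        exact hG.differentiableAt (isOpen_ball.mem_nhds hz)
      fun_prop
    refine le_of_tendsto (hc.tendsto.mono_left (nhdsWithin_le_nhds (s := {z}ᶜ))) ?_
    filter_upwards [self_mem_nhdsWithin, nhdsWithin_le_nhds (isOpen_ball.mem_nhds hz)] with w h1 h2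
    exact hoff w h2 h1
  · exact hoff z hz hza

theorem exists_log_on_ball {h : ℂ → ℂ} {s : ℝ} (hs : 0 < s)
    (hd : DifferentiableOn ℂ h (ball 0 s)) (h0 : ∀ z ∈ ball (0 : ℂ) s, h z ≠ 0) :
    ∃ L : ℂ → ℂ, DifferentiableOn ℂ L (ball 0 s) ∧ L 0 = 0 ∧
      ∀ z ∈ ball (0 : ℂ) s, h z = h 0 * exp (L z) := by
  have hdd : DifferentiableOn ℂ (fun z => deriv h z / h z) (ball 0 s) :=
    (hd.deriv isOpen_ball).div hd h0
  obtain ⟨P, hP⟩ := hdd.isExactOn_ball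
  have hP' : ∀ z ∈ ball (0 : ℂ) s, HasDerivAt P (deriv h z / h z) z := hP
  have hs0 : (0 : ℂ) ∈ ball (0 : ℂ) s := mem_ball_self hs
  refine ⟨fun z => P z - P 0, fun z hz => ?_, by simp, fun z hz => ?_⟩
  · exact ((hP' z hz).differentiableAt.sub_const _).differentiableWithinAt
  · have hder : ∀ z ∈ ball (0 : ℂ) s, HasDerivAt (fun z => h z * exp (-(P z - P 0))) 0 z := by
      intro z hz
      have h1 := (hd.differentiableAt (isOpen_ball.mem_nhds hz)).hasDerivAt
      have h2 := ((hP' z hz).sub_const (P 0)).neg.cexp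
      refine (h1.mul h2).congr_deriv ?_
      have := h0 z hz
      field_simp
      ring
    have := (convex_ball (0 : ℂ) s).is_const_of_fderivWithin_eq_zero (𝕜 := ℂ)
      (f := fun z => h z * exp (-(P z - P 0)))
      (fun z hz => (hder z hz).differentiableAt.differentiableWithinAt)
      (fun z hz => by
        rw [fderivWithin_of_isOpen isOpen_ball hz]
        simpa using (hder z hz).hasFDerivAt.fderiv) hz hs0
    simp only [sub_self, neg_zero, exp_zero, mul_one] at this
    rw [← this, mul_assoc, ← exp_add]
    simp

theorem harnack_lower_bound {h : ℂ → ℂ} {s : ℝ} {b : ℂ}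
    (hd : DifferentiableOn ℂ h (ball 0 s)) (h0 : ∀ z ∈ ball (0 : ℂ) s, h z ≠ 0)
    (h1 : ∀ z ∈ ball (0 : ℂ) s, ‖h z‖ ≤ 1) (hb : b ∈ ball (0 : ℂ) s) :
    Real.exp (-((s + ‖b‖) / (s - ‖b‖) * (-Real.log ‖h 0‖))) ≤ ‖h b‖ := by
  have hbs : ‖b‖ < s := by simpa using hb
  have hs : 0 < s := (norm_nonneg b).trans_lt hbs
  have hs0 : (0 : ℂ) ∈ ball (0 : ℂ) s := mem_ball_self hs
  obtain ⟨L, hL, hL0, hLe⟩ := exists_log_on_ball hs hd h0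
  have hpos : 0 < ‖h 0‖ := norm_pos_iff.mpr (h0 0 hs0)
  set m := -Real.log ‖h 0‖ with hm
  have hm0 : 0 ≤ m := by
    have := Real.log_nonpos (norm_nonneg (h 0)) (h1 0 hs0)
    linarith
  have hre : ∀ z ∈ ball (0 : ℂ) s, ‖h z‖ = Real.exp ((L z).re - m) := by
    intro z hz
    rw [hLe z hz, norm_mul, norm_exp, sub_eq_add_neg, Real.exp_add, hm, neg_neg, Real.exp_log hpos,
      mul_comm]
  have hBC : ∀ δ > 0, ‖L b‖ ≤ 2 * (m + δ) * ‖b‖ / (s - ‖b‖) := by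
    intro δ hδ
    refine borelCaratheodory_zero (by positivity) hL (fun z hz => ?_) hs hb hL0
    have h2 := h1 z hz
    rw [hre z hz, Real.exp_le_one_iff] at h2
    simp only [mem_ofPred_eq]
    linarith
  have hBC0 : ‖L b‖ ≤ 2 * (m + 0) * ‖b‖ / (s - ‖b‖) := by
    have hc : ContinuousAt (fun δ : ℝ => 2 * (m + δ) * ‖b‖ / (s - ‖b‖)) 0 := by fun_prop
    refine ge_of_tendsto (hc.tendsto.mono_left (nhdsWithin_le_nhds (s := Ioi 0))) ?_
    filter_upwards [self_mem_nhdsWithin] with δ hδ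
    exact hBC δ hδ
  rw [hre b hb, Real.exp_le_exp]
  have h3 := (abs_le.mp ((abs_re_le_norm _).trans hBC0)).1
  have h4 : (s + ‖b‖) / (s - ‖b‖) * m = m + 2 * (m + 0) * ‖b‖ / (s - ‖b‖) := by
    have : s - ‖b‖ ≠ 0 := by linarith
    field_simp
    ring
  linarith

theorem norm_le_exp_of_mul_bounded_aux {F : ℂ → ℂ} {M s : ℝ} {b : ℂ}
    (hF : DifferentiableOn ℂ F (ball 0 1)) (hs : s < 1) (hb : ‖b‖ < s) (n : ℕ) :
    ∀ h : ℂ → ℂ, DifferentiableOn ℂ h (ball 0 1) → (∀ z ∈ ball (0 : ℂ) 1, ‖h z‖ ≤ 1) →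
      (∀ z ∈ ball (0 : ℂ) 1, ‖F z * h z‖ ≤ M) → h 0 ≠ 0 → s ^ n < ‖h 0‖ →
      ‖F b‖ ≤ M * Real.exp ((s + ‖b‖) / (s - ‖b‖) * (-Real.log ‖h 0‖)) := by
  have hs0 : 0 < s := (norm_nonneg b).trans_lt hb
  have hsub : ball (0 : ℂ) s ⊆ ball 0 1 := ball_subset_ball hs.le
  have hbs : b ∈ ball (0 : ℂ) s := by simpa using hb
  induction n with
  | zero =>
    intro h _ h1 _ _ hlt
    have := h1 0 (by simp)
    simp at hlt
    linarith
  | succ n ih =>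
    intro h hd h1 hFh h00 hlt
    have hM : 0 ≤ M := (norm_nonneg _).trans (hFh 0 (by simp))
    by_cases hz : ∀ z ∈ ball (0 : ℂ) s, h z ≠ 0
    · have hH := harnack_lower_bound (hd.mono hsub) hz (fun z hz => h1 z (hsub hz)) hbs
      have h2 := hFh b (hsub hbs)
      rw [norm_mul] at h2
      rw [Real.exp_neg] at hH
      set E := Real.exp ((s + ‖b‖) / (s - ‖b‖) * (-Real.log ‖h 0‖)) with hE
      have hEpos : 0 < E := Real.exp_pos _
      calc ‖F b‖ = (‖F b‖ * E⁻¹) * E := by field_simp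
        _ ≤ (‖F b‖ * ‖h b‖) * E := by gcongr
        _ ≤ M * E := by gcongr
    · push Not at hz
      obtain ⟨a, ha, ha0⟩ := hz
      have ha1 := hsub ha
      have hna : a ≠ 0 := by rintro rfl; exact h00 ha0
      set h' : ℂ → ℂ := fun z => dslope h a z * (1 - (starRingEnd ℂ) a * z) with hh'
      have hmem := isOpen_ball.mem_nhds ha1
      have hd' : DifferentiableOn ℂ h' (ball 0 1) :=
        ((differentiableOn_dslope hmem).mpr hd).mul (by fun_prop)
      have h1' : ∀ z ∈ ball (0 : ℂ) 1, ‖h' z‖ ≤ 1 := fun z hz =>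
        norm_dslope_mul_le_of_zero hd h1 ha1 ha0 hz
      have hds : ∀ z ∈ ball (0 : ℂ) 1, dslope (fun w => F w * h w) a z = F z * dslope h a z := by
        intro z hz
        by_cases hza : z = a
        · subst hza
          rw [dslope_same, dslope_same]
          have e1 := (hF.differentiableAt hmem).hasDerivAt
          have e2 := (hd.differentiableAt hmem).hasDerivAt
          have : deriv (fun w => F w * h w) z = _ := (e1.mul e2).deriv
          rw [this, ha0]
          simp
        · rw [dslope_of_ne _ hza, dslope_of_ne _ hza, slope_def_field, slope_def_field, ha0]
          ring
      have hFh' : ∀ z ∈ ball (0 : ℂ) 1, ‖F z * h' z‖ ≤ M := by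
        intro z hz
        have := norm_dslope_mul_le_of_zero (hF.mul hd) hFh ha1 (by simp [ha0]) hz
        rw [show (F * h) = fun w => F w * h w from rfl, hds z hz] at this
        simpa [hh', mul_assoc] using this
      have h'0 : h' 0 = h 0 / (-a) := by
        simp only [hh', dslope_of_ne _ hna.symm, slope_def_field, ha0]
        simp
      have hle : ‖h 0‖ ≤ ‖h' 0‖ := by
        rw [h'0, norm_div, norm_neg, le_div_iff₀ (norm_pos_iff.mpr hna)]
        have : ‖a‖ < 1 := by simpa using ha1
        nlinarith [norm_nonneg (h 0)]
      have hlt' : s ^ n < ‖h' 0‖ := by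
        rw [h'0, norm_div, norm_neg, lt_div_iff₀ (norm_pos_iff.mpr hna)]
        have : ‖a‖ < s := by simpa using ha
        have := pow_pos hs0 n
        rw [pow_succ] at hlt
        nlinarith
      have h'00 : h' 0 ≠ 0 := by
        rw [h'0]; exact div_ne_zero h00 (neg_ne_zero.mpr hna)
      refine (ih h' hd' h1' hFh' h'00 hlt').trans ?_
      gcongr

/-- If a product `F h` is bounded in the disc and `h` is bounded by one, then `F` is controlled
by the value of `h` at the centre. -/
theorem norm_le_exp_of_mul_bounded {F h : ℂ → ℂ} {M : ℝ} {b : ℂ}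
    (hF : DifferentiableOn ℂ F (ball 0 1)) (hd : DifferentiableOn ℂ h (ball 0 1))
    (h1 : ∀ z ∈ ball (0 : ℂ) 1, ‖h z‖ ≤ 1) (hFh : ∀ z ∈ ball (0 : ℂ) 1, ‖F z * h z‖ ≤ M)
    (h00 : h 0 ≠ 0) (hb : ‖b‖ < 1) :
    ‖F b‖ ≤ M * Real.exp ((1 + ‖b‖) / (1 - ‖b‖) * (-Real.log ‖h 0‖)) := by
  have hne : (1 : ℝ) - ‖b‖ ≠ 0 := by linarith
  have hc : ContinuousAt (fun s : ℝ =>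
      M * Real.exp ((s + ‖b‖) / (s - ‖b‖) * (-Real.log ‖h 0‖))) 1 := by
    fun_prop (disch := assumption)
  refine ge_of_tendsto (hc.tendsto.mono_left (nhdsWithin_le_nhds (s := Iio 1))) ?_
  filter_upwards [self_mem_nhdsWithin, nhdsWithin_le_nhds (isOpen_Ioi.mem_nhds hb)] with s hs hbs
  obtain ⟨n, hn⟩ := exists_pow_lt_of_lt_one (norm_pos_iff.mpr h00) hs
  exact norm_le_exp_of_mul_bounded_aux hF hs hbs n h hd h1 hFh h00 hn

theorem norm_le_of_singular_bound_on_axis {Φ : ℂ → ℂ} {ρ B : ℝ} (hρ : 0 < ρ) (hB : 0 < B)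
    (hd : DifferentiableOn ℂ Φ (ball 0 (2 * ρ)))
    (hb : ∀ w ∈ ball (0 : ℂ) (2 * ρ), w.re ≠ 0 → ‖Φ w‖ ≤ Real.exp (B / |w.re|))
    {w : ℂ} (hw : ‖w‖ ≤ ρ / 2) : ‖Φ w‖ ≤ Real.exp (16 * B / ρ) := by
  have hnorm : ∀ z : ℂ, ‖z‖ ≤ |z.re| + |z.im| := norm_le_abs_re_add_abs_im
  have hsub : {z : ℂ | |z.re| + |z.im| ≤ ρ} ⊆ ball (0 : ℂ) (2 * ρ) := by
    intro z hz
    rw [mem_ball_zero_iff]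
    have := hnorm z
    simp only [mem_ofPred_eq] at hz
    linarith
  have hcl : closure {z : ℂ | |z.re| + |z.im| < ρ} ⊆ {z : ℂ | |z.re| + |z.im| ≤ ρ} :=
    closure_lt_subset_le (by fun_prop) (by fun_prop)
  have hfr : frontier {z : ℂ | |z.re| + |z.im| < ρ} ⊆ {z : ℂ | |z.re| + |z.im| = ρ} :=
    frontier_lt_subset_eq (by fun_prop) (by fun_prop)
  have hbd : Bornology.IsBounded {z : ℂ | |z.re| + |z.im| < ρ} :=
    isBounded_ball.subset (fun z hz => hsub (by rw [mem_ofPred_eq] at hz ⊢; exact hz.le))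
  have hcpt : IsCompact (closure {z : ℂ | |z.re| + |z.im| < ρ}) := hbd.isCompact_closure
  obtain ⟨K, hK⟩ := hcpt.exists_bound_of_continuousOn
    (hd.continuousOn.mono (hcl.trans hsub))
  obtain ⟨η, hη, hηK⟩ : ∃ η > 0, K ≤ Real.exp (B / η) := by
    refine ⟨B / (|K| + 1), by positivity, ?_⟩
    have h1 : B / (B / (|K| + 1)) = |K| + 1 := by field_simp
    rw [h1]
    have := Real.add_one_le_exp (|K| + 1)
    have := le_abs_self K
    linarith
  have hre1 : ∀ z : ℂ, |z.re| + |z.im| ≤ ρ → η ≤ ((ρ : ℂ) + η + I * z).re := by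
    intro z hz
    simp
    have := le_abs_self z.im
    have := abs_nonneg z.re
    linarith
  have hre2 : ∀ z : ℂ, |z.re| + |z.im| ≤ ρ → η ≤ ((ρ : ℂ) + η - I * z).re := by
    intro z hz
    simp
    have := neg_abs_le z.im
    have := abs_nonneg z.re
    linarith
  have hne1 : ∀ z : ℂ, |z.re| + |z.im| ≤ ρ → ((ρ : ℂ) + η + I * z) ≠ 0 := by
    intro z hz h
    have := hre1 z hz
    rw [h] at this
    simp at this
    linarith
  have hne2 : ∀ z : ℂ, |z.re| + |z.im| ≤ ρ → ((ρ : ℂ) + η - I * z) ≠ 0 := by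
    intro z hz h
    have := hre2 z hz
    rw [h] at this
    simp at this
    linarith
  have hinv : ∀ u : ℂ, 0 < u.re → 0 ≤ (1 / u).re := by
    intro u hu
    rw [one_div, inv_re]
    exact div_nonneg hu.le (normSq_nonneg _)
  have hpos1 : ∀ z : ℂ, |z.re| + |z.im| ≤ ρ → 0 ≤ (1 / ((ρ : ℂ) + η + I * z)).re :=
    fun z hz => hinv _ (hη.trans_le (hre1 z hz))
  have hpos2 : ∀ z : ℂ, |z.re| + |z.im| ≤ ρ → 0 ≤ (1 / ((ρ : ℂ) + η - I * z)).re :=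
    fun z hz => hinv _ (hη.trans_le (hre2 z hz))
  set E : ℂ → ℂ := fun z => -(4 * B) * (1 / ((ρ : ℂ) + η + I * z) + 1 / ((ρ : ℂ) + η - I * z))
    with hE
  have hEre : ∀ z, (E z).re = -(4 * B) * ((1 / ((ρ : ℂ) + η + I * z)).re +
      (1 / ((ρ : ℂ) + η - I * z)).re) := by
    intro z
    have : E z = ((-(4 * B) : ℝ) : ℂ) *
      (1 / ((ρ : ℂ) + η + I * z) + 1 / ((ρ : ℂ) + η - I * z)) := by
      simp [hE]
    rw [this, re_ofReal_mul, add_re]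
  have hdE : DifferentiableOn ℂ (fun z => Φ z * exp (E z)) {z : ℂ | |z.re| + |z.im| ≤ ρ} := by
    refine (hd.mono hsub).mul (DifferentiableOn.cexp ?_)
    intro z hz
    have h1 := hne1 z hz
    have h2 := hne2 z hz
    apply DifferentiableAt.differentiableWithinAt
    simp only [hE]
    fun_prop (disch := assumption)
  have hmax : ∀ z ∈ frontier {z : ℂ | |z.re| + |z.im| < ρ}, ‖Φ z * exp (E z)‖ ≤ 1 := by
    intro z hz
    have hzeq : |z.re| + |z.im| = ρ := hfr hz
    have hzle := hzeq.le
    have hzK := hK z (frontier_subset_closure hz)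
    have hsum : 1 / (2 * (|z.re| + η)) ≤ (1 / ((ρ : ℂ) + η + I * z)).re +
        (1 / ((ρ : ℂ) + η - I * z)).re := by
      have key : ∀ u : ℂ, u.re = |z.re| + η → |u.im| = |z.re| →
          1 / (2 * (|z.re| + η)) ≤ (1 / u).re := by
        intro u h1 h2
        have h0 := abs_nonneg z.re
        have : u.im * u.im = |z.re| * |z.re| := by rw [← h2, abs_mul_abs_self]
        rw [one_div u, inv_re, normSq_apply, h1, this,
          div_le_div_iff₀ (by positivity) (by positivity)]
        nlinarith
      rcases le_total 0 z.im with him | him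
      · rw [abs_of_nonneg him] at hzeq
        have := key ((ρ : ℂ) + η + I * z) (by simp; linarith) (by simp)
        linarith [hpos2 z hzle]
      · rw [abs_of_nonpos him] at hzeq
        have := key ((ρ : ℂ) + η - I * z) (by simp; linarith) (by simp)
        linarith [hpos1 z hzle]
    rw [norm_mul, norm_exp, hEre]
    set S := (1 / ((ρ : ℂ) + η + I * z)).re + (1 / ((ρ : ℂ) + η - I * z)).re
    have h0 := abs_nonneg z.re
    rcases le_or_gt η |z.re| with ht | ht
    · have htp := hη.trans_le ht
      have h1 := hb z (hsub hzle) (abs_pos.mp htp)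
      have h2 : 1 / (4 * |z.re|) ≤ S := by
        refine le_trans ?_ hsum
        apply one_div_le_one_div_of_le (by positivity)
        linarith
      calc ‖Φ z‖ * Real.exp (-(4 * B) * S)
          ≤ Real.exp (B / |z.re|) * Real.exp (-(4 * B) * (1 / (4 * |z.re|))) := by
            gcongr ?_ * Real.exp ?_
            nlinarith
        _ = 1 := by
            rw [← Real.exp_add, Real.exp_eq_one_iff]
            field_simp
            ring
    · have h2 : 1 / (4 * η) ≤ S := by
        refine le_trans ?_ hsum
        apply one_div_le_one_div_of_le (by positivity)
        linarith
      calc ‖Φ z‖ * Real.exp (-(4 * B) * S)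
          ≤ Real.exp (B / η) * Real.exp (-(4 * B) * (1 / (4 * η))) := by
            gcongr ?_ * Real.exp ?_
            · exact hzK.trans hηK
            · nlinarith
        _ = 1 := by
            rw [← Real.exp_add, Real.exp_eq_one_iff]
            field_simp
            ring
  have hw1 := (abs_re_le_norm w).trans hw
  have hw2 := (abs_im_le_norm w).trans hw
  have hwle : |w.re| + |w.im| ≤ ρ := by linarith
  have hwcl : w ∈ closure {z : ℂ | |z.re| + |z.im| < ρ} := by
    have hcl2 : closure (ball (0 : ℂ) (ρ / 2)) ⊆ closure {z : ℂ | |z.re| + |z.im| < ρ} := by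
      apply closure_mono
      intro z hz
      rw [mem_ball_zero_iff] at hz
      have := abs_re_le_norm z
      have := abs_im_le_norm z
      simp only [mem_ofPred_eq]
      linarith
    apply hcl2
    rw [closure_ball _ (by positivity)]
    simpa using hw
  have hfin := norm_le_of_forall_mem_frontier_norm_le hbd
    ((hdE.mono hcl).diffContOnCl) hmax hwcl
  rw [norm_mul, norm_exp, hEre] at hfin
  have hub : ∀ u : ℂ, ρ / 2 ≤ u.re → (1 / u).re ≤ 2 / ρ := by
    intro u hu
    have h1 : 0 < u.re := by linarith
    rw [one_div, inv_re, div_le_div_iff₀ (normSq_pos.mpr (by rintro rfl; simp at h1)) hρ,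
      normSq_apply]
    nlinarith [mul_self_nonneg u.im]
  have hu1 := hub ((ρ : ℂ) + η + I * w) (by simp; linarith [le_abs_self w.im])
  have hu2 := hub ((ρ : ℂ) + η - I * w) (by simp; linarith [neg_abs_le w.im])
  set S := (1 / ((ρ : ℂ) + η + I * w)).re + (1 / ((ρ : ℂ) + η - I * w)).re
  have hS : S ≤ 4 / ρ := by
    have : 2 / ρ + 2 / ρ = 4 / ρ := by ring
    linarith
  calc ‖Φ w‖ = (‖Φ w‖ * Real.exp (-(4 * B) * S)) * Real.exp (4 * B * S) := by
        rw [mul_assoc, ← Real.exp_add]; simp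
    _ ≤ 1 * Real.exp (4 * B * (4 / ρ)) := by gcongr
    _ = _ := by rw [one_mul]; congr 1; ring

theorem exponential_type_of_singular_bound {Φ : ℂ → ℂ} {R C : ℝ} (hR : 0 < R) (hC : 0 < C)
    (hd : DifferentiableOn ℂ Φ {w | R < ‖w‖})
    (hb : ∀ w : ℂ, R < ‖w‖ → w.re ≠ 0 → ‖Φ w‖ ≤ Real.exp (C * ‖w‖ ^ 2 / |w.re|)) {w : ℂ}
    (hw : 4 * R < ‖w‖) : ‖Φ w‖ ≤ Real.exp (256 * C * ‖w‖) := by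
  have hw0 : 0 < ‖w‖ := by linarith
  rcases le_or_gt (‖w‖ / 8) |w.re| with h | h
  · have hpos : 0 < |w.re| := lt_of_lt_of_le (by positivity) h
    refine (hb w (by linarith) (abs_pos.mp hpos)).trans ?_
    rw [Real.exp_le_exp, div_le_iff₀ hpos]
    have : 0 < C * ‖w‖ := by positivity
    nlinarith
  · set p : ℂ := w.im * I with hp
    have hwp : w - p = w.re := by
      apply Complex.ext <;> simp [hp]
    have hpn : ‖w‖ * (7 / 8) ≤ ‖p‖ := by
      have h1 : ‖w‖ ≤ ‖w - p‖ + ‖p‖ := by simpa using norm_add_le (w - p) p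
      rw [hwp, norm_real, Real.norm_eq_abs] at h1
      linarith
    have hpn2 : ‖p‖ ≤ ‖w‖ := by
      simpa [hp] using abs_im_le_norm w
    have hball : ∀ u ∈ ball (0 : ℂ) (2 * (‖w‖ / 4)), R < ‖p + u‖ ∧ ‖p + u‖ ≤ 2 * ‖w‖ := by
      intro u hu
      rw [mem_ball_zero_iff] at hu
      constructor
      · have h1 : ‖p‖ ≤ ‖p + u‖ + ‖u‖ := by simpa using norm_sub_le (p + u) u
        linarith
      · have := norm_add_le p u
        linarith
    have := norm_le_of_singular_bound_on_axis (Φ := fun u => Φ (p + u)) (ρ := ‖w‖ / 4)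
      (B := 4 * C * ‖w‖ ^ 2) (by positivity) (by positivity)
      (hd.comp (by fun_prop) (fun u hu => (hball u hu).1))
      (fun u hu hu0 => by
        obtain ⟨h1, h2⟩ := hball u hu
        have hre : (p + u).re = u.re := by simp [hp]
        refine (hb _ h1 (by rwa [hre])).trans ?_
        rw [hre, Real.exp_le_exp]
        refine div_le_div_of_nonneg_right ?_ (abs_nonneg _)
        have := pow_le_pow_left₀ (norm_nonneg _) h2 2
        nlinarith) (w := w - p) (by rw [hwp, norm_real, Real.norm_eq_abs]; linarith)
    simp only [add_sub_cancel] at this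
    refine this.trans (le_of_eq ?_)
    congr 1
    field_simp
    ring

theorem sq_re_eq_of_sq_eq {s q : ℂ} (h : s ^ 2 = q) : s.re ^ 2 = (‖q‖ + q.re) / 2 := by
  have h1 : ‖q‖ = s.re ^ 2 + s.im ^ 2 := by
    rw [← h, norm_pow, ← normSq_eq_norm_sq, normSq_apply]; ring
  have h2 : q.re = s.re ^ 2 - s.im ^ 2 := by
    rw [← h, sq, mul_re]; ring
  rw [h1, h2]; ring

theorem exists_sq_eq_re_nonneg (q : ℂ) : ∃ s : ℂ, s ^ 2 = q ∧ 0 ≤ s.re := by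
  obtain ⟨s, hs⟩ := IsAlgClosed.exists_pow_nat_eq q (n := 2) (by norm_num)
  rcases le_total 0 s.re with h | h
  · exact ⟨s, hs, h⟩
  · exact ⟨-s, by rw [neg_sq, hs], by simpa using h⟩

/-- The principal branch of `√(v + 1)`. -/
def shiftedSqrt (v : ℂ) : ℂ := exp (log (v + 1) / 2)

theorem shiftedSqrt_sq {v : ℂ} (hv : 0 ≤ v.re) : shiftedSqrt v ^ 2 = v + 1 := by
  have : v + 1 ≠ 0 := by
    intro h
    have := congrArg re h
    simp at this
    linarith
  rw [shiftedSqrt, ← exp_nat_mul, Nat.cast_ofNat, mul_div_cancel₀ _ (two_ne_zero), exp_log this]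

theorem shiftedSqrt_re_pos {v : ℂ} (hv : 0 ≤ v.re) : 0 < (shiftedSqrt v).re := by
  rw [shiftedSqrt, exp_re]
  refine mul_pos (Real.exp_pos _) (Real.cos_pos_of_mem_Ioo ?_)
  have h1 : |(v + 1).arg| < Real.pi / 2 := by
    rw [abs_arg_lt_pi_div_two_iff]
    left
    simp
    linarith
  have h2 := abs_lt.mp h1
  have : (log (v + 1) / 2).im = (v + 1).arg / 2 := by
    rw [← log_im]; simp
  rw [this]
  constructor <;> linarith [Real.pi_pos]

theorem differentiableAt_shiftedSqrt {v : ℂ} (hv : 0 ≤ v.re) :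
    DifferentiableAt ℂ shiftedSqrt v := by
  have : v + 1 ∈ slitPlane := by
    left
    simp
    linarith
  unfold shiftedSqrt
  exact ((DifferentiableAt.clog (f := fun v => v + 1) (by fun_prop) this).div_const 2).cexp

theorem norm_shiftedSqrt_sq_le {v : ℂ} (hv : 0 ≤ v.re) : ‖shiftedSqrt v‖ ^ 2 ≤ ‖v‖ + 1 := by
  rw [← norm_pow, shiftedSqrt_sq hv]
  simpa using norm_add_le v 1

theorem exists_bound_of_exponential_type {Φ : ℂ → ℂ} {R C : ℝ} (hR : 0 < R) (hC : 0 < C)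
    (hd1 : DifferentiableOn ℂ Φ {w | R < ‖w‖}) (hd2 : DifferentiableOn ℂ Φ {w | 0 < w.re})
    (hexp : ∀ w : ℂ, R < ‖w‖ → ‖Φ w‖ ≤ Real.exp (C * ‖w‖))
    (hleft : ∀ w : ℂ, R < ‖w‖ → w.re < 0 → ‖Φ w‖ ≤ C / |w.re|)
    (hreal : ∀ ε > 0, ∃ M X : ℝ, ∀ x : ℝ, X ≤ x → ‖Φ x‖ ≤ M * Real.exp (ε * x)) :
    ∃ R' K : ℝ, ∀ w : ℂ, R' < ‖w‖ → ‖Φ w‖ ≤ K := by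
  obtain ⟨K, hK⟩ : ∃ K : ℝ, K = R + 4 := ⟨_, rfl⟩
  set m : ℂ → ℂ := fun v => v + K - shiftedSqrt v with hm
  have hmre : ∀ v, (m v).re = v.re + K - (shiftedSqrt v).re := by intro v; simp [hm]
  have hlow : ∀ v : ℂ, ‖v‖ - K - ‖shiftedSqrt v‖ ≤ ‖m v‖ := by
    intro v
    have h1 : ‖v‖ ≤ ‖m v‖ + ‖shiftedSqrt v - K‖ := by
      have := norm_add_le (m v) (shiftedSqrt v - K)
      simpa [hm] using this
    have h2 : ‖shiftedSqrt v - K‖ ≤ ‖shiftedSqrt v‖ + K := by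
      have := norm_sub_le (shiftedSqrt v) (K : ℂ)
      rwa [norm_real, Real.norm_eq_abs, abs_of_pos (by linarith)] at this
    linarith
  have hup : ∀ v : ℂ, ‖m v‖ ≤ ‖v‖ + K + ‖shiftedSqrt v‖ := by
    intro v
    have h1 := norm_sub_le (v + K) (shiftedSqrt v)
    have h2 := norm_add_le v (K : ℂ)
    rw [norm_real, Real.norm_eq_abs, abs_of_pos (by linarith)] at h2
    linarith
  have hmap : ∀ v : ℂ, 0 ≤ v.re → 0 < (m v).re ∨ R < ‖m v‖ := by
    intro v hv
    rw [or_iff_not_imp_left, not_lt]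
    intro h
    rw [hmre] at h
    have h1 := norm_shiftedSqrt_sq_le hv
    have h2 := re_le_norm (shiftedSqrt v)
    have h3 := hlow v
    have h4 : K ≤ ‖shiftedSqrt v‖ := by linarith
    nlinarith
  have hdm : ∀ v : ℂ, 0 ≤ v.re → DifferentiableAt ℂ m v := by
    intro v hv
    have := differentiableAt_shiftedSqrt hv
    simp only [hm]
    fun_prop
  have hdΨ : ∀ v : ℂ, 0 ≤ v.re → DifferentiableAt ℂ (Φ ∘ m) v := by
    intro v hv
    refine DifferentiableAt.comp v ?_ (hdm v hv)
    rcases hmap v hv with h | h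
    · exact hd2.differentiableAt ((isOpen_lt continuous_const continuous_re).mem_nhds h)
    · exact hd1.differentiableAt ((isOpen_lt continuous_const continuous_norm).mem_nhds h)
  obtain ⟨C1, hC1⟩ : ∃ C1 : ℝ, ∀ y : ℝ, ‖Φ (m (y * I))‖ ≤ C1 := by
    set T : ℝ := 2 * (K + 1) ^ 2
    have hcont : Continuous fun y : ℝ => Φ (m (y * I)) := by
      rw [continuous_iff_continuousAt]
      intro y
      have h1 : ContinuousAt (Φ ∘ m) ((y : ℂ) * I) := (hdΨ _ (by simp)).continuousAt
      exact ContinuousAt.comp (f := fun y : ℝ => (y : ℂ) * I) h1 (by fun_prop)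
    obtain ⟨C0, hC0⟩ := (isCompact_Icc (a := -T) (b := T)).exists_bound_of_continuousOn
      hcont.continuousOn
    refine ⟨max C0 C, fun y => ?_⟩
    rcases le_or_gt |y| T with h | h
    · exact (hC0 y (abs_le.mp h)).trans (le_max_left _ _)
    · refine le_trans ?_ (le_max_right _ _)
      have hv : 0 ≤ ((y : ℂ) * I).re := by simp
      have h1 := sq_re_eq_of_sq_eq (shiftedSqrt_sq hv)
      have h2 := shiftedSqrt_re_pos hv
      have h3 : |y| ≤ ‖(y : ℂ) * I + 1‖ := by
        simpa using abs_im_le_norm ((y : ℂ) * I + 1)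
      have h4 : (((y : ℂ) * I) + 1).re = 1 := by simp
      rw [h4] at h1
      have h5 : K + 1 ≤ (shiftedSqrt (y * I)).re := by
        refine (pow_le_pow_iff_left₀ (by linarith) h2.le two_ne_zero).mp ?_
        nlinarith
      have h6 : (m (y * I)).re ≤ -1 := by
        rw [hmre]; simp; linarith
      have h7 : R < ‖m (y * I)‖ := (hmap _ hv).resolve_left (by linarith)
      refine (hleft _ h7 (by linarith)).trans (div_le_self hC.le ?_)
      rw [abs_of_neg (by linarith)]
      linarith
  have hmain : ∀ v : ℂ, 0 ≤ v.re → ∀ ε > 0, ‖Φ (m v) * exp (-(ε : ℝ) * v)‖ ≤ C1 := by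
    intro v hv ε hε
    refine PhragmenLindelof.right_half_plane_of_bounded_on_real
      (f := fun v => Φ (m v) * exp (-(ε : ℝ) * v)) ?_ ⟨1, by norm_num, 3 * C, ?_⟩ ?_ ?_ hv
    · apply DifferentiableOn.diffContOnCl
      rw [closure_setOfPred_lt_re]
      intro z hz
      have h1 := hdΨ z hz
      exact (h1.mul (by fun_prop)).differentiableWithinAt
    · apply Asymptotics.IsBigO.of_bound 1
      have hbig : ∀ᶠ z : ℂ in Bornology.cobounded ℂ, 4 * (R + K + 2) ≤ ‖z‖ :=
        tendsto_norm_cobounded_atTop.eventually_ge_atTop _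
      filter_upwards [hbig.filter_mono inf_le_left, mem_inf_of_right (mem_principal_self _)]
        with z hz hz0
      have hz0 : 0 < z.re := hz0
      have h1 := norm_shiftedSqrt_sq_le hz0.le
      have h2 := hlow z
      have h3 := hup z
      have h4 : ‖shiftedSqrt z‖ ≤ ‖shiftedSqrt z‖ ^ 2 / 4 + 1 := by
        nlinarith [sq_nonneg (‖shiftedSqrt z‖ / 2 - 1)]
      have h5 := hexp (m z) (by linarith)
      rw [norm_mul, norm_exp, one_mul, Real.rpow_one, Real.norm_eq_abs, Real.abs_exp]
      have h6 : (-(ε : ℂ) * z).re = -(ε * z.re) := by simp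
      rw [h6]
      calc ‖Φ (m z)‖ * Real.exp (-(ε * z.re)) ≤ Real.exp (C * ‖m z‖) * 1 := by
            gcongr
            rw [Real.exp_le_one_iff]
            have := mul_pos hε hz0
            linarith
        _ ≤ Real.exp (3 * C * ‖z‖) := by
            rw [mul_one, Real.exp_le_exp]
            nlinarith
    · obtain ⟨M, X, hM⟩ := hreal ε hε
      refine ⟨|M| * Real.exp (ε * K), ?_⟩
      rw [eventually_map]
      filter_upwards [eventually_ge_atTop (max 0 (4 * |X| + 4))] with x hx
      have hx0 : 0 ≤ x := (le_max_left _ _).trans hx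
      have hxX : 4 * |X| + 4 ≤ x := (le_max_right _ _).trans hx
      obtain ⟨σ, hσ⟩ : ∃ σ : ℝ, σ = Real.sqrt (x + 1) := ⟨_, rfl⟩
      have hσ2 : σ ^ 2 = x + 1 := by rw [hσ]; exact Real.sq_sqrt (by linarith)
      have hσ0 : 0 ≤ σ := by rw [hσ]; exact Real.sqrt_nonneg _
      have hs : shiftedSqrt x = σ := by
        have hv : 0 ≤ (x : ℂ).re := by simpa using hx0
        have h1 := shiftedSqrt_sq hv
        have h2 : ((σ : ℂ)) ^ 2 = x + 1 := by exact_mod_cast hσ2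
        rw [← h2] at h1
        rcases sq_eq_sq_iff_eq_or_eq_neg.mp h1 with h | h
        · exact h
        · have h3 := shiftedSqrt_re_pos hv
          rw [h] at h3
          simp at h3
          linarith
      have hmx : m x = ((x + K - σ : ℝ) : ℂ) := by simp [hm, hs]
      rw [hmx, norm_mul, norm_exp]
      have h6 : (-(ε : ℂ) * x).re = -(ε * x) := by simp
      rw [h6]
      have h7 := hM (x + K - σ) (by nlinarith [sq_nonneg (σ / 2 - 1), le_abs_self X])
      calc ‖Φ ((x + K - σ : ℝ) : ℂ)‖ * Real.exp (-(ε * x))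
          ≤ (|M| * Real.exp (ε * (x + K))) * Real.exp (-(ε * x)) := by
            gcongr
            refine h7.trans ?_
            gcongr
            · exact le_abs_self M
            · linarith
        _ = |M| * Real.exp (ε * K) := by
            rw [mul_assoc, ← Real.exp_add]; congr 2; ring
    · intro y
      have h6 : (-(ε : ℂ) * (y * I)).re = 0 := by simp
      rw [norm_mul, norm_exp, h6, Real.exp_zero, mul_one]
      exact hC1 y
  have hΨ : ∀ v : ℂ, 0 ≤ v.re → ‖Φ (m v)‖ ≤ C1 := by
    intro v hv
    have hc : ContinuousAt (fun ε : ℝ => ‖Φ (m v) * exp (-(ε : ℝ) * v)‖) 0 := by fun_prop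
    have ht := hc.tendsto.mono_left (nhdsWithin_le_nhds (s := Ioi 0))
    simp only [ofReal_zero, neg_zero, zero_mul, exp_zero, mul_one] at ht
    refine le_of_tendsto ht ?_
    filter_upwards [self_mem_nhdsWithin] with ε hε
    exact hmain v hv ε hε
  refine ⟨R + 2 * (K + 2) ^ 2 + 4 * K, max C C1, fun w hw => ?_⟩
  rcases le_or_gt w.re (-1) with h | h
  · refine le_trans ?_ (le_max_left _ _)
    refine (hleft w (by nlinarith) (by linarith)).trans (div_le_self hC.le ?_)
    rw [abs_of_neg (by linarith)]
    linarith
  · refine le_trans ?_ (le_max_right _ _)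
    obtain ⟨σ, hσ, hσ0⟩ := exists_sq_eq_re_nonneg (w - K + 5 / 4)
    have h1 := sq_re_eq_of_sq_eq hσ
    have hre : (w - K + 5 / 4 : ℂ).re = w.re - K + 5 / 4 := by simp
    have hnorm : ‖w‖ - K - 5 / 4 ≤ ‖(w - K + 5 / 4 : ℂ)‖ := by
      have h2 : ‖w‖ ≤ ‖(w - K + 5 / 4 : ℂ)‖ + ‖(K : ℂ) - 5 / 4‖ := by
        have := norm_add_le (w - K + 5 / 4 : ℂ) ((K : ℂ) - 5 / 4)
        simpa using this
      have h3 : ‖(K : ℂ) - 5 / 4‖ ≤ K + 5 / 4 := by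
        have := norm_sub_le (K : ℂ) (5 / 4)
        rw [norm_real, Real.norm_eq_abs, abs_of_pos (by linarith)] at this
        norm_num at this ⊢
        exact this
      linarith
    have h4 : K + 1 ≤ σ.re := by
      refine (pow_le_pow_iff_left₀ (by linarith) hσ0 two_ne_zero).mp ?_
      rw [h1, hre]
      nlinarith
    obtain ⟨s, hs⟩ : ∃ s : ℂ, s = 1 / 2 + σ := ⟨_, rfl⟩
    have hsre : s.re = 1 / 2 + σ.re := by rw [hs]; simp
    have hs2 : s ^ 2 - 1 = w - K + s := by
      have : σ = s - 1 / 2 := by rw [hs]; ring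
      rw [this] at hσ
      linear_combination hσ
    have hv : 0 ≤ (s ^ 2 - 1).re := by
      rw [hs2]
      simp
      linarith
    have h5 : shiftedSqrt (s ^ 2 - 1) = s := by
      have h6 := shiftedSqrt_sq hv
      rw [sub_add_cancel] at h6
      rcases sq_eq_sq_iff_eq_or_eq_neg.mp h6 with h | h
      · exact h
      · have h3 := shiftedSqrt_re_pos hv
        rw [h] at h3
        simp at h3
        linarith
    have h7 := hΨ _ hv
    have h8 : m (s ^ 2 - 1) = w := by
      simp only [hm, h5]
      rw [hs2]; ring
    rwa [h8] at h7

theorem norm_lt_norm_of_half_plane {c x₀ : ℝ} (hx : c < x₀) {w : ℂ} (hw : c < w.re) :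
    ‖w - x₀‖ < ‖w - 2 * c + x₀‖ := by
  apply lt_of_pow_lt_pow_left₀ 2 (norm_nonneg _)
  rw [← normSq_eq_norm_sq, ← normSq_eq_norm_sq, normSq_apply, normSq_apply]
  simp
  nlinarith [mul_pos (sub_pos.mpr hx) (sub_pos.mpr hw)]

/-- Half-plane version of `norm_le_exp_of_mul_bounded`. -/
theorem norm_le_exp_of_mul_bounded_half_plane {F g : ℂ → ℂ} {M c x₀ : ℝ} (hx : c < x₀)
    (hF : DifferentiableOn ℂ F {w | c < w.re}) (hg : DifferentiableOn ℂ g {w | c < w.re})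
    (h1 : ∀ w : ℂ, c < w.re → ‖g w‖ ≤ 1) (hFg : ∀ w : ℂ, c < w.re → ‖F w * g w‖ ≤ M)
    (h0 : g x₀ ≠ 0) {w : ℂ} (hw : c < w.re) :
    ‖F w‖ ≤ M * Real.exp ((‖w - 2 * c + x₀‖ + ‖w - x₀‖) / (‖w - 2 * c + x₀‖ - ‖w - x₀‖) *
      (-Real.log ‖g x₀‖)) := by
  set T : ℂ → ℂ := fun ξ => c + (x₀ - c) * ((1 + ξ) / (1 - ξ)) with hT
  have hne : ∀ ξ ∈ ball (0 : ℂ) 1, 1 - ξ ≠ 0 := by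
    intro ξ hξ h
    rw [← sub_eq_zero.mp h] at hξ
    simp at hξ
  have hmaps : MapsTo T (ball 0 1) {w | c < w.re} := by
    intro ξ hξ
    have h2 : 0 < ((1 + ξ) / (1 - ξ)).re := by
      have h3 := normSq_pos.mpr (hne ξ hξ)
      rw [div_re, ← add_div]
      refine div_pos ?_ h3
      have : ξ.re ^ 2 + ξ.im ^ 2 < 1 := by
        have h4 : ‖ξ‖ < 1 := by simpa using hξ
        have : ‖ξ‖ ^ 2 < 1 := by nlinarith [norm_nonneg ξ]
        rwa [← normSq_eq_norm_sq, normSq_apply, ← sq, ← sq] at this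
      simp
      nlinarith
    have h5 : (T ξ).re = c + (x₀ - c) * ((1 + ξ) / (1 - ξ)).re := by
      have : T ξ = (c : ℂ) + ((x₀ - c : ℝ) : ℂ) * ((1 + ξ) / (1 - ξ)) := by simp [hT]
      rw [this, add_re, re_ofReal_mul, ofReal_re]
    have h6 : c < (T ξ).re := by
      rw [h5]
      nlinarith [mul_pos (sub_pos.mpr hx) h2]
    exact h6
  have hTd : DifferentiableOn ℂ T (ball 0 1) := by
    intro ξ hξ
    have := hne ξ hξ
    apply DifferentiableAt.differentiableWithinAt
    simp only [hT]
    fun_prop (disch := assumption)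
  have hT0 : T 0 = x₀ := by simp [hT]
  have hlt := norm_lt_norm_of_half_plane hx hw
  have hpos : 0 < ‖w - 2 * c + x₀‖ := (norm_nonneg _).trans_lt hlt
  have hq : w - 2 * c + x₀ ≠ 0 := norm_pos_iff.mp hpos
  set b : ℂ := (w - x₀) / (w - 2 * c + x₀) with hb
  have hb1 : ‖b‖ < 1 := by rwa [hb, norm_div, div_lt_one hpos]
  have hTb : T b = w := by
    have h2 := hne b (by simpa using hb1)
    have h3 : b * (w - 2 * c + x₀) = w - x₀ := div_mul_cancel₀ _ hq
    simp only [hT]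
    field_simp
    linear_combination h3
  have := norm_le_exp_of_mul_bounded (F := F ∘ T) (h := g ∘ T) (M := M) (b := b)
    (hF.comp hTd hmaps) (hg.comp hTd hmaps) (fun z hz => h1 _ (hmaps hz))
    (fun z hz => hFg _ (hmaps hz)) (by simpa [hT0] using h0) hb1
  simp only [Function.comp, hTb, hT0] at this
  refine this.trans (le_of_eq ?_)
  congr 3
  have h4 : ‖w - 2 * c + x₀‖ - ‖w - x₀‖ ≠ 0 := by linarith
  rw [hb, norm_div]
  field_simp

theorem neg_log_le_of_exp_le {t y : ℝ} (h : Real.exp (-t) ≤ y) : -Real.log y ≤ t := by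
  have := (Real.le_log_iff_exp_le ((Real.exp_pos _).trans_le h)).mpr h
  linarith

theorem norm_le_exp_on_reals {Φ g : ℂ → ℂ} {M x₀ ε : ℝ} (hε : 0 < ε) (hx₀ : 2 ≤ x₀)
    (hΦ : DifferentiableOn ℂ Φ {w | 0 < w.re}) (hg : DifferentiableOn ℂ g {w | 0 < w.re})
    (hg1 : ∀ w : ℂ, 0 < w.re → ‖g w‖ ≤ 1) (hΦg : ∀ w : ℂ, 0 < w.re → ‖Φ w * g w‖ ≤ M / w.re)
    (hgx : Real.exp (-(ε / 2 * x₀)) ≤ ‖g x₀‖) {x : ℝ} (hx : x₀ ≤ x) :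
    ‖Φ x‖ ≤ M * Real.exp (ε * x) := by
  have hsub : {w : ℂ | 1 < w.re} ⊆ {w : ℂ | 0 < w.re} := fun w (hw : 1 < w.re) =>
    zero_lt_one.trans hw
  have hg0 : g x₀ ≠ 0 := norm_pos_iff.mp ((Real.exp_pos _).trans_le hgx)
  have hgl := neg_log_le_of_exp_le hgx
  have hM : 0 ≤ M := by
    have := (norm_nonneg _).trans (hΦg 1 (by simp))
    simpa using this
  have h2 := norm_le_exp_of_mul_bounded_half_plane (F := Φ) (g := g) (M := M) (c := 1)
    (x₀ := x₀) (by linarith) (hΦ.mono hsub) (hg.mono hsub)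
    (fun w hw => hg1 w (by linarith))
    (fun w hw => (hΦg w (by linarith)).trans (div_le_self hM hw.le)) hg0 (w := x)
    (by simp; linarith)
  refine h2.trans (mul_le_mul_of_nonneg_left (Real.exp_le_exp.mpr ?_) hM)
  have e1 : ‖(x : ℂ) - 2 * (1 : ℝ) + x₀‖ = x - 2 + x₀ := by
    have : (x : ℂ) - 2 * (1 : ℝ) + x₀ = ((x - 2 + x₀ : ℝ) : ℂ) := by push_cast; ring
    rw [this, norm_real, Real.norm_eq_abs, abs_of_pos (by linarith)]
  have e2 : ‖(x : ℂ) - x₀‖ = x - x₀ := by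
    rw [← ofReal_sub, norm_real, Real.norm_eq_abs, abs_of_nonneg (by linarith)]
  rw [e1, e2]
  have h3 : 0 < x - 2 + x₀ - (x - x₀) := by linarith
  calc (x - 2 + x₀ + (x - x₀)) / (x - 2 + x₀ - (x - x₀)) * -Real.log ‖g x₀‖
      ≤ (x - 2 + x₀ + (x - x₀)) / (x - 2 + x₀ - (x - x₀)) * (ε / 2 * x₀) := by
        refine mul_le_mul_of_nonneg_left hgl (div_nonneg (by linarith) h3.le)
    _ ≤ ε * x := by
        rw [div_mul_eq_mul_div, div_le_iff₀ h3]
        nlinarith [mul_nonneg hε.le (by linarith : 0 ≤ x), mul_pos hε (by linarith : 0 < x₀)]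

theorem half_plane_kernel_le {c x₀ : ℝ} {w : ℂ} (hx₀ : 2 ≤ x₀) (hc0 : 0 < c) (hc1 : c ≤ 1)
    (hc2 : c ≤ w.re / 2) (hw : x₀ ≤ ‖w‖) :
    (‖w - 2 * c + x₀‖ + ‖w - x₀‖) / (‖w - 2 * c + x₀‖ - ‖w - x₀‖) ≤ 8 * (‖w‖ ^ 2 / w.re) := by
  have hlt := norm_lt_norm_of_half_plane (c := c) (x₀ := x₀) (by linarith)
    (w := w) (by linarith)
  have hP : ‖w - 2 * c + x₀‖ ≤ 2 * ‖w‖ := by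
    have h3 := norm_add_le w ((x₀ - 2 * c : ℝ) : ℂ)
    rw [norm_real, Real.norm_eq_abs, abs_of_nonneg (by linarith)] at h3
    have h4 : w + ((x₀ - 2 * c : ℝ) : ℂ) = w - 2 * c + x₀ := by push_cast; ring
    rw [h4] at h3
    linarith
  have hPN : ‖w - 2 * c + x₀‖ ^ 2 - ‖w - x₀‖ ^ 2 = 4 * (x₀ - c) * (w.re - c) := by
    rw [← normSq_eq_norm_sq, ← normSq_eq_norm_sq, normSq_apply, normSq_apply]
    simp
    ring
  have hN0 : 0 ≤ ‖w - x₀‖ := norm_nonneg _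
  generalize ‖w - 2 * c + x₀‖ = P at *
  generalize ‖w - x₀‖ = N at *
  have hpos : 0 < w.re := by linarith
  rw [div_le_iff₀ (by linarith)]
  have h5 : 2 * w.re ≤ P ^ 2 - N ^ 2 := by
    rw [hPN]
    nlinarith
  have h7 : ‖w‖ ^ 2 / w.re * w.re = ‖w‖ ^ 2 := by field_simp
  have hQ0 : 0 ≤ ‖w‖ ^ 2 / w.re := by positivity
  generalize ‖w‖ ^ 2 / w.re = Q at *
  have h6 : (P + N) * (P + N) ≤ 8 * Q * (P - N) * (P + N) := by
    calc (P + N) * (P + N) ≤ (2 * P) * (2 * P) := by gcongr <;> linarith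
      _ ≤ 4 * (2 * ‖w‖) ^ 2 := by nlinarith
      _ = 8 * (Q * (2 * w.re)) := by linear_combination (-16) * h7
      _ ≤ 8 * (Q * (P ^ 2 - N ^ 2)) := by gcongr
      _ = _ := by ring
  exact le_of_mul_le_mul_right h6 (by linarith)

theorem norm_le_exp_on_half_plane {Φ g : ℂ → ℂ} {M x₀ : ℝ} (hx₀ : 2 ≤ x₀)
    (hΦ : DifferentiableOn ℂ Φ {w | 0 < w.re}) (hg : DifferentiableOn ℂ g {w | 0 < w.re})
    (hg1 : ∀ w : ℂ, 0 < w.re → ‖g w‖ ≤ 1) (hΦg : ∀ w : ℂ, 0 < w.re → ‖Φ w * g w‖ ≤ M / w.re)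
    (hgx : Real.exp (-x₀) ≤ ‖g x₀‖) {w : ℂ} (hw : x₀ ≤ ‖w‖) (hpos : 0 < w.re) :
    ‖Φ w‖ ≤ Real.exp ((M + 2 + 8 * x₀) * (‖w‖ ^ 2 / w.re)) := by
  have hg0 : g x₀ ≠ 0 := norm_pos_iff.mp ((Real.exp_pos _).trans_le hgx)
  have hgl := neg_log_le_of_exp_le hgx
  have hM : 0 ≤ M := by
    have := (norm_nonneg _).trans (hΦg 1 (by simp))
    simpa using this
  obtain ⟨c, hc⟩ : ∃ c, c = min (w.re / 2) 1 := ⟨_, rfl⟩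
  have hc0 : 0 < c := by rw [hc]; positivity
  have hc1 : c ≤ 1 := by rw [hc]; exact min_le_right _ _
  have hc2 : c ≤ w.re / 2 := by rw [hc]; exact min_le_left _ _
  have hsub : {w : ℂ | c < w.re} ⊆ {w : ℂ | 0 < w.re} := fun w (hw : c < w.re) => hc0.trans hw
  have hκ := half_plane_kernel_le hx₀ hc0 hc1 hc2 hw
  have h2 := norm_le_exp_of_mul_bounded_half_plane (F := Φ) (g := g) (M := M / c) (c := c)
    (x₀ := x₀) (by linarith) (hΦ.mono hsub) (hg.mono hsub)
    (fun u hu => hg1 u (by linarith))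
    (fun u hu => (hΦg u (by linarith)).trans (by gcongr)) hg0 (w := w) (by linarith)
  have hlog0 : 0 ≤ -Real.log ‖g x₀‖ := by
    have := Real.log_nonpos (norm_nonneg _) (hg1 x₀ (by simp; linarith))
    linarith
  have hle := re_le_norm w
  have hQ1 : 1 ≤ ‖w‖ ^ 2 / w.re := by
    rw [le_div_iff₀ hpos]
    nlinarith
  have hQ2 : 1 / w.re ≤ ‖w‖ ^ 2 / w.re := by
    gcongr
    nlinarith
  generalize ‖w‖ ^ 2 / w.re = Q at *
  have hcinv : M / c ≤ M * (2 * Q) := by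
    rw [div_eq_mul_inv]
    refine mul_le_mul_of_nonneg_left ?_ hM
    rw [inv_le_iff_one_le_mul₀ hc0]
    rw [div_le_iff₀ hpos] at hQ2
    rcases min_choice (w.re / 2) 1 with h | h
    · rw [hc, h]; linarith
    · rw [hc, h]; linarith
  have hcexp : M / c ≤ Real.exp ((M + 2) * Q) := by
    refine hcinv.trans ?_
    have hM1 : M ≤ Real.exp (M * Q) := by
      have := Real.add_one_le_exp (M * Q)
      nlinarith
    have hQ3 : 2 * Q ≤ Real.exp (2 * Q) := by linarith [Real.add_one_le_exp (2 * Q)]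
    rw [add_mul, Real.exp_add]
    exact mul_le_mul hM1 hQ3 (by linarith) (Real.exp_pos _).le
  refine h2.trans ((mul_le_mul hcexp (Real.exp_le_exp.mpr (mul_le_mul hκ hgl hlog0 (by linarith)))
    (Real.exp_pos _).le (Real.exp_pos _).le).trans ?_)
  rw [← Real.exp_add, Real.exp_le_exp]
  linarith

theorem exists_bound_near_infinity {Φ : ℂ → ℂ} {R C : ℝ} (hR : 1 ≤ R) (hC : 0 < C)
    (hd1 : DifferentiableOn ℂ Φ {w | R < ‖w‖}) (hd2 : DifferentiableOn ℂ Φ {w | 0 < w.re})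
    (hleft : ∀ w : ℂ, R < ‖w‖ → w.re < 0 → ‖Φ w‖ ≤ C / |w.re|)
    (hright : ∀ ε > 0, ∃ (g : ℂ → ℂ) (M x₀ : ℝ), 2 ≤ x₀ ∧ DifferentiableOn ℂ g {w | 0 < w.re} ∧
      (∀ w : ℂ, 0 < w.re → ‖g w‖ ≤ 1) ∧ (∀ w : ℂ, 0 < w.re → ‖Φ w * g w‖ ≤ M / w.re) ∧
      Real.exp (-(ε * x₀)) ≤ ‖g x₀‖) :
    ∃ R' K : ℝ, ∀ w : ℂ, R' < ‖w‖ → ‖Φ w‖ ≤ K := by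
  have hreal : ∀ ε > 0, ∃ M X : ℝ, ∀ x : ℝ, X ≤ x → ‖Φ x‖ ≤ M * Real.exp (ε * x) := by
    intro ε hε
    obtain ⟨g, M, x₀, hx₀, hg, hg1, hΦg, hgx⟩ := hright (ε / 2) (by positivity)
    exact ⟨M, x₀, fun x hx => norm_le_exp_on_reals hε hx₀ hd2 hg hg1 hΦg hgx hx⟩
  obtain ⟨g, M, x₀, hx₀, hg, hg1, hΦg, hgx⟩ := hright 1 one_pos
  have hM : 0 ≤ M := by
    have := (norm_nonneg _).trans (hΦg 1 (by simp))
    simpa using this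
  obtain ⟨A, hA⟩ : ∃ A : ℝ, A = C + (M + 2 + 8 * x₀) := ⟨_, rfl⟩
  have hsing : ∀ w : ℂ, R + x₀ < ‖w‖ → w.re ≠ 0 → ‖Φ w‖ ≤ Real.exp (A * ‖w‖ ^ 2 / |w.re|) := by
    intro w hw hre
    have habs := abs_pos.mpr hre
    rw [mul_div_assoc]
    have hQ0 : 0 ≤ ‖w‖ ^ 2 / |w.re| := by positivity
    rcases lt_or_gt_of_ne hre with hneg | hpos
    · have hQ2 : 1 / |w.re| ≤ ‖w‖ ^ 2 / |w.re| := by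
        gcongr
        nlinarith
      calc ‖Φ w‖ ≤ C / |w.re| := hleft w (by linarith) hneg
        _ = C * (1 / |w.re|) := by ring
        _ ≤ A * (‖w‖ ^ 2 / |w.re|) := by
            refine mul_le_mul (by linarith) hQ2 (by positivity) (by linarith)
        _ ≤ Real.exp (A * (‖w‖ ^ 2 / |w.re|)) := by
            linarith [Real.add_one_le_exp (A * (‖w‖ ^ 2 / |w.re|))]
    · refine (norm_le_exp_on_half_plane hx₀ hd2 hg hg1 hΦg (by simpa using hgx)
        (by linarith) hpos).trans ?_
      rw [abs_of_pos hpos] at hQ0 ⊢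
      rw [Real.exp_le_exp]
      exact mul_le_mul_of_nonneg_right (by linarith) hQ0
  have hd1' : DifferentiableOn ℂ Φ {w | R + x₀ < ‖w‖} := hd1.mono fun w (hw : R + x₀ < ‖w‖) => by
    rw [mem_ofPred_eq]; linarith
  have hA0 : 0 < A := by linarith
  have hexp : ∀ w : ℂ, 4 * (R + x₀) < ‖w‖ → ‖Φ w‖ ≤ Real.exp (256 * A * ‖w‖) := fun w hw =>
    exponential_type_of_singular_bound (by linarith) hA0 hd1' hsing hw
  refine exists_bound_of_exponential_type (R := 4 * (R + x₀)) (C := max C (256 * A)) (by linarith)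
    (lt_max_of_lt_left hC) (hd1.mono fun w (hw : 4 * (R + x₀) < ‖w‖) => by
      rw [mem_ofPred_eq]; linarith) hd2
    (fun w hw => (hexp w hw).trans ?_) (fun w hw hre => (hleft w (by linarith) hre).trans ?_) hreal
  · gcongr
    exact le_max_right _ _
  · gcongr
    exact le_max_left _ _

theorem norm_cayley_sq {ζ w : ℂ} (hζ : ‖ζ‖ = 1) (hw : w + 1 ≠ 0) :
    ‖ζ * (w - 1) / (w + 1)‖ ^ 2 = 1 - 4 * w.re / ‖w + 1‖ ^ 2 := by
  have h1 : ‖w - 1‖ ^ 2 = ‖w + 1‖ ^ 2 - 4 * w.re := by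
    rw [← normSq_eq_norm_sq, ← normSq_eq_norm_sq, normSq_apply, normSq_apply]
    simp
    ring
  have h2 : ‖w + 1‖ ≠ 0 := norm_ne_zero_iff.mpr hw
  rw [norm_div, norm_mul, hζ, one_mul, div_pow, h1]
  field_simp

theorem exists_sq_mul_bound_near_point {F : ℂ → ℂ} {ζ : ℂ} {ρ C : ℝ} (hζ : ‖ζ‖ = 1) (hρ : 0 < ρ)
    (hC : 0 < C) (hF1 : DifferentiableOn ℂ F (ball 0 1))
    (hF2 : DifferentiableOn ℂ F (ball ζ ρ \ {ζ}))
    (hout : ∀ z : ℂ, 1 < ‖z‖ → ‖F z‖ ≤ C / (‖z‖ - 1))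
    (hin : ∀ ε > 0, ∃ (g : ℂ → ℂ) (M x₀ : ℝ), 2 ≤ x₀ ∧ DifferentiableOn ℂ g (ball 0 1) ∧
      (∀ z ∈ ball (0 : ℂ) 1, ‖g z‖ ≤ 1) ∧
      (∀ z ∈ ball (0 : ℂ) 1, ‖F z * g z‖ ≤ M / (1 - ‖z‖)) ∧
      Real.exp (-(ε * x₀)) ≤ ‖g (ζ * (x₀ - 1) / (x₀ + 1))‖) :
    ∃ δ > 0, ∃ K : ℝ, ∀ z : ℂ, z ≠ ζ → ‖z - ζ‖ < δ → ‖(z - ζ) ^ 2 * F z‖ ≤ K := by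
  have hζ0 : ζ ≠ 0 := by rintro rfl; simp at hζ
  set T : ℂ → ℂ := fun w => ζ * (w - 1) / (w + 1) with hT
  have hTζ : ∀ w : ℂ, w + 1 ≠ 0 → T w - ζ = -(2 * ζ) / (w + 1) := by
    intro w hw
    simp only [hT]
    field_simp
    ring
  obtain ⟨R, hR⟩ : ∃ R : ℝ, R = 3 + 2 / ρ := ⟨_, rfl⟩
  have hρ2 : 0 < 2 / ρ := by positivity
  have hbig : ∀ w : ℂ, R < ‖w‖ → 2 < ‖w + 1‖ ∧ 2 / ρ < ‖w + 1‖ := by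
    intro w hw
    have : ‖w‖ ≤ ‖w + 1‖ + 1 := by simpa using norm_sub_le (w + 1) 1
    constructor <;> linarith
  have hne1 : ∀ w : ℂ, R < ‖w‖ → w + 1 ≠ 0 := by
    intro w hw
    apply norm_pos_iff.mp
    linarith [(hbig w hw).1]
  have hne2 : ∀ w : ℂ, 0 < w.re → w + 1 ≠ 0 := by
    intro w hw h
    have := congrArg re h
    simp at this
    linarith
  have hmap1 : MapsTo T {w | R < ‖w‖} (ball ζ ρ \ {ζ}) := by
    intro w hw
    have hw : R < ‖w‖ := hw
    have h1 := hTζ w (hne1 w hw)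
    have h2 := (hbig w hw).2
    constructor
    · rw [mem_ball, dist_eq_norm, h1, norm_div, norm_neg, norm_mul, hζ, mul_one,
        div_lt_iff₀ (by linarith)]
      rw [div_lt_iff₀ hρ] at h2
      simp
      linarith
    · intro h
      rw [mem_singleton_iff.mp h, sub_self] at h1
      have : -(2 * ζ) / (w + 1) ≠ 0 :=
        div_ne_zero (neg_ne_zero.mpr (mul_ne_zero two_ne_zero hζ0)) (hne1 w hw)
      exact this h1.symm
  have hmap2 : MapsTo T {w | 0 < w.re} (ball 0 1) := by
    intro w hw
    have hw : 0 < w.re := hw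
    have h1 := norm_cayley_sq hζ (hne2 w hw)
    have h2 : 0 < ‖w + 1‖ := norm_pos_iff.mpr (hne2 w hw)
    have h3 : 0 < 4 * w.re / ‖w + 1‖ ^ 2 := by positivity
    rw [mem_ball_zero_iff]
    simp only [hT]
    nlinarith [norm_nonneg (ζ * (w - 1) / (w + 1))]
  have hTd : ∀ w : ℂ, w + 1 ≠ 0 → DifferentiableAt ℂ T w := by
    intro w hw
    simp only [hT]
    fun_prop (disch := assumption)
  set Φ : ℂ → ℂ := fun w => F (T w) / (w + 1) ^ 2 with hΦ
  have hd1 : DifferentiableOn ℂ Φ {w | R < ‖w‖} := by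
    refine (hF2.comp (fun w hw => (hTd w (hne1 w hw)).differentiableWithinAt) hmap1).div
      (by fun_prop) (fun w hw => pow_ne_zero 2 (hne1 w hw))
  have hd2 : DifferentiableOn ℂ Φ {w | 0 < w.re} := by
    refine (hF1.comp (fun w hw => (hTd w (hne2 w hw)).differentiableWithinAt) hmap2).div
      (by fun_prop) (fun w hw => pow_ne_zero 2 (hne2 w hw))
  obtain ⟨R', K, hK⟩ := exists_bound_near_infinity (Φ := Φ) (R := R) (C := C) (by linarith) hC
    hd1 hd2 (fun w hw hre => by
      have h1 := norm_cayley_sq hζ (hne1 w hw)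
      have h2 := (hbig w hw).1
      set N := ‖T w‖ with hN
      have h1 : N ^ 2 = 1 - 4 * w.re / ‖w + 1‖ ^ 2 := h1
      have h3 : N ≤ 3 := by
        have h4 := hTζ w (hne1 w hw)
        have h5 : ‖T w - ζ‖ ≤ 1 := by
          rw [h4, norm_div, norm_neg, norm_mul, hζ, mul_one, div_le_one (by linarith)]
          simp
          linarith
        have := norm_le_norm_add_norm_sub' (T w) ζ
        linarith
      have hN0 : 0 ≤ N := norm_nonneg _
      have h6 : (N ^ 2 - 1) * ‖w + 1‖ ^ 2 = -4 * w.re := by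
        rw [h1]
        field_simp
        ring
      have h7 : 1 < N := by
        by_contra hcon
        push Not at hcon
        have : (N ^ 2 - 1) * ‖w + 1‖ ^ 2 ≤ 0 :=
          mul_nonpos_of_nonpos_of_nonneg (by nlinarith) (sq_nonneg _)
        linarith
      have h8 := hout (T w) h7
      simp only [hΦ]
      rw [norm_div, norm_pow, abs_of_neg hre]
      have h9 : (N - 1) * ‖w + 1‖ ^ 2 ≥ -w.re := by
        nlinarith [mul_nonneg (mul_nonneg (by linarith : 0 ≤ N - 1) (by linarith : 0 ≤ 3 - N))
          (sq_nonneg ‖w + 1‖)]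
      calc ‖F (T w)‖ / ‖w + 1‖ ^ 2 ≤ C / (N - 1) / ‖w + 1‖ ^ 2 := by gcongr
        _ = C / ((N - 1) * ‖w + 1‖ ^ 2) := by rw [div_div]
        _ ≤ C / -w.re := by
          apply div_le_div_of_nonneg_left hC.le (by linarith) h9)
    (fun ε hε => by
      obtain ⟨g, M, x₀, hx₀, hg, hg1, hFg, hgx⟩ := hin ε hε
      have hM : 0 ≤ M := by
        have := (norm_nonneg _).trans (hFg 0 (by simp))
        simpa using this
      refine ⟨g ∘ T, M, x₀, hx₀, hg.comp
        (fun w hw => (hTd w (hne2 w hw)).differentiableWithinAt) hmap2,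
        fun w hw => hg1 _ (hmap2 hw), fun w hw => ?_, hgx⟩
      have h1 := norm_cayley_sq hζ (hne2 w hw)
      have h2 : 0 < ‖w + 1‖ := norm_pos_iff.mpr (hne2 w hw)
      have h3 := hFg _ (hmap2 hw)
      have h4 : ‖T w‖ < 1 := by simpa using hmap2 hw
      set N := ‖T w‖ with hN
      have h1 : N ^ 2 = 1 - 4 * w.re / ‖w + 1‖ ^ 2 := h1
      have hN0 : 0 ≤ N := norm_nonneg _
      have h6 : (1 - N ^ 2) * ‖w + 1‖ ^ 2 = 4 * w.re := by
        rw [h1]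
        field_simp
        ring
      have h9 : w.re ≤ (1 - N) * ‖w + 1‖ ^ 2 := by
        nlinarith [mul_nonneg (mul_nonneg (by linarith : 0 ≤ 1 - N) (by linarith : 0 ≤ 1 - N))
          (sq_nonneg ‖w + 1‖)]
      simp only [hΦ, Function.comp]
      rw [div_mul_eq_mul_div, norm_div, norm_pow]
      calc ‖F (T w) * g (T w)‖ / ‖w + 1‖ ^ 2 ≤ M / (1 - N) / ‖w + 1‖ ^ 2 := by gcongr
        _ = M / ((1 - N) * ‖w + 1‖ ^ 2) := by rw [div_div]
        _ ≤ M / w.re := by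
          apply div_le_div_of_nonneg_left hM hw h9)
  refine ⟨2 / (|R'| + 2), by positivity, 4 * |K|, fun z hz hzδ => ?_⟩
  have hz0 : ζ - z ≠ 0 := sub_ne_zero.mpr hz.symm
  have hzn : 0 < ‖z - ζ‖ := norm_pos_iff.mpr (sub_ne_zero.mpr hz)
  obtain ⟨w, hw⟩ : ∃ w : ℂ, w = (ζ + z) / (ζ - z) := ⟨_, rfl⟩
  have hw1 : w + 1 = 2 * ζ / (ζ - z) := by
    rw [hw]
    field_simp
    ring
  have hw1n : ‖w + 1‖ = 2 / ‖z - ζ‖ := by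
    rw [hw1, norm_div, norm_mul, hζ, norm_sub_rev]
    simp
  have hTw : T w = z := by
    have h1 : w - 1 = 2 * z / (ζ - z) := by
      rw [hw]
      field_simp
      ring
    simp only [hT]
    rw [hw1, h1]
    field_simp
  have hwR : R' < ‖w‖ := by
    have h1 : ‖w + 1‖ ≤ ‖w‖ + 1 := by simpa using norm_add_le w 1
    have h2 : |R'| + 2 < ‖w + 1‖ := by
      rw [hw1n, lt_div_iff₀ hzn]
      rw [lt_div_iff₀ (by positivity)] at hzδ
      linarith
    linarith [le_abs_self R']
  have h3 := hK w hwR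
  simp only [hΦ] at h3
  rw [hTw, norm_div, norm_pow, hw1n] at h3
  rw [norm_mul, norm_pow]
  have h4 : ‖F z‖ / (2 / ‖z - ζ‖) ^ 2 = ‖z - ζ‖ ^ 2 * ‖F z‖ / 4 := by
    field_simp
    norm_num
  rw [h4] at h3
  linarith [le_abs_self K]

/-- A function with at most a double pole at `ζ`, such that `(r - 1) F(rζ) → 0` as `r → 1+`, has
vanishing integral around `ζ`. -/
theorem circleIntegral_eq_zero_of_sq_mul_bounded {F : ℂ → ℂ} {ζ : ℂ} {ρ δ K : ℝ}
    (hζ : ‖ζ‖ = 1) (hδ : 0 < δ)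
    (hF : DifferentiableOn ℂ F (ball ζ ρ \ {ζ}))
    (hb : ∀ z, z ≠ ζ → ‖z - ζ‖ < δ → ‖(z - ζ) ^ 2 * F z‖ ≤ K)
    (hrad : Tendsto (fun r : ℝ => ((r : ℂ) - 1) * F (r * ζ)) (nhdsWithin 1 (Ioi 1)) (nhds 0))
    {r : ℝ} (hr : 0 < r) (hrρ : r < ρ) : (∮ z in C(ζ, r), F z) = 0 := by
  have hρ : 0 < ρ := hr.trans hrρ
  have hζ0 : ζ ≠ 0 := by
    rintro rfl
    simp at hζ
  have hball : ball ζ ρ ∈ nhds ζ := ball_mem_nhds ζ hρ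
  set G : ℂ → ℂ := fun z => (z - ζ) ^ 2 * F z with hG
  have hGd : DifferentiableOn ℂ G (ball ζ ρ \ {ζ}) := by
    apply DifferentiableOn.mul _ hF
    fun_prop
  set m := min ρ δ with hm
  have hm0 : 0 < m := lt_min hρ hδ
  -- the ray outside the disc
  have hray : Tendsto (fun t : ℝ => (t : ℂ) * ζ) (nhdsWithin 1 (Ioi 1)) (nhdsWithin ζ {ζ}ᶜ) := by
    apply tendsto_nhdsWithin_of_tendsto_nhds_of_eventually_within
    · have : Continuous fun t : ℝ => (t : ℂ) * ζ := by fun_prop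
      have h1 := this.tendsto 1
      simp only [ofReal_one, one_mul] at h1
      exact h1.mono_left nhdsWithin_le_nhds
    · filter_upwards [self_mem_nhdsWithin] with t ht
      simp only [mem_compl_iff, mem_singleton_iff]
      intro h
      have h2 : (t : ℂ) = 1 := mul_right_cancel₀ hζ0 (by rw [h, one_mul])
      have : t = 1 := by exact_mod_cast h2
      exact absurd this (ne_of_gt ht)
  have hrad' : Tendsto (fun t : ℝ => ((t : ℂ) * ζ - ζ) * F (t * ζ)) (nhdsWithin 1 (Ioi 1))
      (nhds 0) := by
    have := hrad.const_mul ζ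
    rw [mul_zero] at this
    refine this.congr fun t => ?_
    ring
  have hradG : Tendsto (fun t : ℝ => G (t * ζ)) (nhdsWithin 1 (Ioi 1)) (nhds 0) := by
    have h1 : Tendsto (fun t : ℝ => (t : ℂ) * ζ - ζ) (nhdsWithin 1 (Ioi 1)) (nhds 0) := by
      have := (hray.mono_right nhdsWithin_le_nhds).sub_const ζ
      rwa [sub_self] at this
    have := h1.mul hrad'
    rw [mul_zero] at this
    refine this.congr fun t => ?_
    simp only [hG]
    ring
  have hGd' : DifferentiableOn ℂ G (ball ζ m \ {ζ}) :=
    hGd.mono (sdiff_subset_sdiff_left (ball_subset_ball (min_le_left _ _)))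
  have hbdd : BddAbove (norm ∘ G '' (ball ζ m \ {ζ})) := by
    refine ⟨K, ?_⟩
    rintro _ ⟨z, ⟨hz, hz'⟩, rfl⟩
    refine hb z hz' ?_
    rw [mem_ball, dist_eq_norm] at hz
    exact hz.trans_le (min_le_right _ _)
  have hupd := Complex.differentiableOn_update_limUnder_of_bddAbove (ball_mem_nhds ζ hm0) hGd' hbdd
  have hlim : Tendsto G (nhdsWithin ζ {ζ}ᶜ) (nhds (limUnder (nhdsWithin ζ {ζ}ᶜ) G)) := by
    have h1 := (hupd.continuousOn.continuousAt (ball_mem_nhds ζ hm0))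
    exact continuousAt_update_same.mp h1
  have hl0 : limUnder (nhdsWithin ζ {ζ}ᶜ) G = 0 :=
    tendsto_nhds_unique (hlim.comp hray) hradG
  rw [hl0] at hlim hupd
  have hGζ : G ζ = 0 := by simp [hG]
  have hupdG : Function.update G ζ 0 = G := by
    rw [← hGζ]; exact Function.update_eq_self _ _
  rw [hupdG] at hupd
  have hG1 : DifferentiableOn ℂ G (ball ζ ρ) := by
    intro z hz
    by_cases hzζ : z = ζ
    · subst hzζ
      exact (hupd.differentiableAt (ball_mem_nhds z hm0)).differentiableWithinAt
    · have : (ball ζ ρ \ {ζ}) ∈ nhds z :=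
        (isOpen_ball.sdiff isClosed_singleton).mem_nhds ⟨hz, hzζ⟩
      exact (hGd.differentiableAt this).differentiableWithinAt
  have hG2 : DifferentiableOn ℂ (dslope G ζ) (ball ζ ρ) :=
    (Complex.differentiableOn_dslope hball).mpr hG1
  have hne : ∀ z, z ≠ ζ → dslope G ζ z = (z - ζ) * F z := by
    intro z hz
    rw [dslope_of_ne _ hz, slope_def_field, hGζ, sub_zero]
    have : z - ζ ≠ 0 := sub_ne_zero.mpr hz
    simp only [hG]
    field_simp
  have hnez : ∀ᶠ t : ℝ in nhdsWithin 1 (Ioi 1), (t : ℂ) * ζ ≠ ζ := by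
    filter_upwards [hray.eventually self_mem_nhdsWithin] with t ht using ht
  have hH0 : dslope G ζ ζ = 0 := by
    have h1 := (hG2.continuousOn.continuousAt hball).tendsto.comp
      (hray.mono_right nhdsWithin_le_nhds)
    refine tendsto_nhds_unique h1 (hrad'.congr' ?_)
    filter_upwards [hnez] with t ht
    rw [Function.comp_apply, hne _ ht]
  have hG3 : DifferentiableOn ℂ (dslope (dslope G ζ) ζ) (ball ζ ρ) :=
    (Complex.differentiableOn_dslope hball).mpr hG2
  have hne2 : ∀ z, z ≠ ζ → dslope (dslope G ζ) ζ z = F z := by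
    intro z hz
    rw [dslope_of_ne _ hz, slope_def_field, hH0, sub_zero, hne z hz]
    have : z - ζ ≠ 0 := sub_ne_zero.mpr hz
    field_simp
  have h0 : (∮ z in C(ζ, r), dslope (dslope G ζ) ζ z) = 0 := by
    apply DiffContOnCl.circleIntegral_eq_zero hr.le
    apply DifferentiableOn.diffContOnCl
    rw [closure_ball ζ hr.ne']
    exact hG3.mono (closedBall_subset_ball hrρ)
  rw [← h0]
  apply circleIntegral.integral_congr hr.le
  intro z hz
  refine (hne2 z ?_).symm
  rintro rfl
  simp at hz
  linarith

theorem summable_coeff_mul {p q : PowerSeries ℂ} (hp : Summable fun n => ‖PowerSeries.coeff n p‖)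
    (hq : Summable fun n => ‖PowerSeries.coeff n q‖) :
    Summable fun n => ‖PowerSeries.coeff n (p * q)‖ := by
  simp only [PowerSeries.coeff_mul]
  exact summable_norm_sum_mul_antidiagonal_of_summable_norm (f := fun n => PowerSeries.coeff n p)
    (g := fun n => PowerSeries.coeff n q) hp hq

theorem summable_coeff_add {p q : PowerSeries ℂ} (hp : Summable fun n => ‖PowerSeries.coeff n p‖)
    (hq : Summable fun n => ‖PowerSeries.coeff n q‖) :
    Summable fun n => ‖PowerSeries.coeff n (p + q)‖ := by
  simp only [map_add]
  exact Summable.of_nonneg_of_le (fun _ => norm_nonneg _) (fun _ => norm_add_le _ _) (hp.add hq)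

theorem summable_coeff_C (c : ℂ) :
    Summable fun n => ‖PowerSeries.coeff n (algebraMap ℂ (PowerSeries ℂ) c)‖ := by
  apply summable_of_ne_finset_zero (s := {0})
  intro n hn
  have hn' : n ≠ 0 := by simpa using hn
  simp [PowerSeries.coeff_C, hn']

/-- The algebra of absolutely summable power series. -/
def absSummableSeries : Subalgebra ℂ (PowerSeries ℂ) where
  carrier := {p | Summable fun n => ‖PowerSeries.coeff n p‖}
  mul_mem' := summable_coeff_mul
  add_mem' := summable_coeff_add
  algebraMap_mem' := summable_coeff_C

/-- The algebra `A⁺`, realised as an algebra of power series. -/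
abbrev AbsSeries := ↥absSummableSeries

namespace AbsSeries

/-- The coefficients of an absolutely summable power series. -/
def coeff (p : AbsSeries) (n : ℕ) : ℂ := PowerSeries.coeff n (p : PowerSeries ℂ)

theorem summable_norm_coeff (p : AbsSeries) : Summable fun n => ‖p.coeff n‖ := p.2

@[ext]
theorem ext {p q : AbsSeries} (h : ∀ n, p.coeff n = q.coeff n) : p = q :=
  Subtype.ext (PowerSeries.ext h)

@[simp] theorem coeff_zero (n : ℕ) : (0 : AbsSeries).coeff n = 0 := by simp [coeff]
@[simp] theorem coeff_add (p q : AbsSeries) (n : ℕ) :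
    (p + q).coeff n = p.coeff n + q.coeff n := by simp [coeff]
@[simp] theorem coeff_neg (p : AbsSeries) (n : ℕ) : (-p).coeff n = -p.coeff n := by simp [coeff]
@[simp] theorem coeff_smul (c : ℂ) (p : AbsSeries) (n : ℕ) :
    (c • p).coeff n = c * p.coeff n := by simp [coeff]
theorem coeff_mul (p q : AbsSeries) (n : ℕ) :
    (p * q).coeff n =
      ∑ kl ∈ Finset.HasAntidiagonal.antidiagonal n, p.coeff kl.1 * q.coeff kl.2 := by
  simp [coeff, PowerSeries.coeff_mul]
theorem coeff_one (n : ℕ) : (1 : AbsSeries).coeff n = if n = 0 then 1 else 0 := by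
  simp [coeff, PowerSeries.coeff_one]

/-- The element with prescribed coefficients. -/
def ofCoeff (a : ℕ → ℂ) (ha : Summable fun n => ‖a n‖) : AbsSeries :=
  ⟨PowerSeries.mk a, by
    change Summable fun n => ‖PowerSeries.coeff n (PowerSeries.mk a)‖
    simpa using ha⟩

@[simp] theorem coeff_ofCoeff (a : ℕ → ℂ) (ha : Summable fun n => ‖a n‖) (n : ℕ) :
    (ofCoeff a ha).coeff n = a n := by simp [ofCoeff, coeff]

/-- The `ℓ¹` norm. -/
def ringNorm : RingNorm AbsSeries where
  toFun p := ∑' n, ‖p.coeff n‖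
  map_zero' := by simp
  add_le' p q := by
    rw [← p.summable_norm_coeff.tsum_add q.summable_norm_coeff]
    exact (p + q).summable_norm_coeff.tsum_le_tsum
      (fun n => by rw [coeff_add]; exact norm_add_le _ _)
      (p.summable_norm_coeff.add q.summable_norm_coeff)
  neg' p := by simp
  mul_le' p q := by
    have hp : Summable fun n => ‖‖p.coeff n‖‖ := by simpa using p.summable_norm_coeff
    have hq : Summable fun n => ‖‖q.coeff n‖‖ := by simpa using q.summable_norm_coeff
    rw [tsum_mul_tsum_eq_tsum_sum_antidiagonal_of_summable_norm hp hq]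
    refine (p * q).summable_norm_coeff.tsum_le_tsum (fun n => ?_)
      (summable_norm_sum_mul_antidiagonal_of_summable_norm hp hq).of_norm
    rw [coeff_mul]
    exact (norm_sum_le _ _).trans (Finset.sum_le_sum fun _ _ => (norm_mul_le _ _))
  eq_zero_of_map_eq_zero' p hp := by
    have h := (hasSum_zero_iff_of_nonneg (fun n => norm_nonneg (p.coeff n))).mp
      (hp ▸ p.summable_norm_coeff.hasSum)
    ext n
    simpa using congrFun h n

instance : NormedCommRing AbsSeries :=
  { ringNorm.toNormedRing, (inferInstance : CommRing AbsSeries) with }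

theorem norm_eq (p : AbsSeries) : ‖p‖ = ∑' n, ‖p.coeff n‖ := rfl

instance : NormedAlgebra ℂ AbsSeries where
  norm_smul_le c p := by
    simp only [norm_eq, coeff_smul, norm_mul]
    rw [tsum_mul_left]

theorem hasSum_norm (p : AbsSeries) : HasSum (fun n => ‖p.coeff n‖) ‖p‖ :=
  p.summable_norm_coeff.hasSum

/-- The coefficients as an element of `ℓ¹`. -/
def toLp (p : AbsSeries) : lp (fun _ : ℕ => ℂ) 1 :=
  ⟨p.coeff, memℓp_gen (by simpa using p.summable_norm_coeff)⟩

theorem isometry_toLp : Isometry toLp := by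
  refine Isometry.of_dist_eq fun p q => ?_
  rw [dist_eq_norm, dist_eq_norm, lp.norm_eq_tsum_rpow (by simp), norm_eq]
  simp [toLp]
  rfl

theorem surjective_toLp : Function.Surjective toLp := fun x => by
  have hx := (lp.memℓp x).summable (by simp)
  simp only [ENNReal.toReal_one, Real.rpow_one] at hx
  refine ⟨ofCoeff x hx, ?_⟩
  ext n
  simp [toLp]

instance : CompleteSpace AbsSeries :=
  ((IsometryEquiv.mk (Equiv.ofBijective toLp ⟨isometry_toLp.injective, surjective_toLp⟩)
    isometry_toLp).completeSpace_iff).mpr inferInstance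

/-- The variable. -/
def X : AbsSeries := ⟨PowerSeries.X, by
  apply summable_of_ne_finset_zero (s := {1})
  intro n hn
  have hn' : n ≠ 1 := by simpa using hn
  simp [PowerSeries.coeff_X, hn']⟩

theorem coeff_X_pow (k n : ℕ) : (X ^ k).coeff n = if n = k then 1 else 0 := by
  have : ((X ^ k : AbsSeries) : PowerSeries ℂ) = PowerSeries.X ^ k := SubmonoidClass.coe_pow X k
  rw [coeff, this, PowerSeries.coeff_X_pow]

theorem norm_X_pow (k : ℕ) : ‖X ^ k‖ = 1 := by
  rw [norm_eq, tsum_eq_single k]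
  · simp [coeff_X_pow]
  · intro n hn
    simp [coeff_X_pow, hn]

theorem norm_X : ‖X‖ = 1 := by simpa using norm_X_pow 1

instance : NormOneClass AbsSeries := ⟨by simpa using norm_X_pow 0⟩

/-- Coefficients are continuous. -/
theorem norm_coeff_le (p : AbsSeries) (n : ℕ) : ‖p.coeff n‖ ≤ ‖p‖ :=
  p.summable_norm_coeff.le_tsum n fun _ _ => norm_nonneg _

/-- The `n`-th coefficient as a continuous linear functional. -/
def coeffL (n : ℕ) : AbsSeries →L[ℂ] ℂ :=
  LinearMap.mkContinuous ⟨⟨fun p => p.coeff n, fun _ _ => coeff_add _ _ _⟩,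
    fun _ _ => coeff_smul _ _ _⟩ 1 fun p => by simpa using norm_coeff_le p n

theorem summable_smul_X_pow {a : ℕ → ℂ} (ha : Summable fun n => ‖a n‖) :
    Summable fun n => a n • X ^ n := by
  apply Summable.of_norm
  simpa [norm_smul, norm_X_pow] using ha

theorem hasSum_X_pow (p : AbsSeries) : HasSum (fun n => p.coeff n • X ^ n) p := by
  have h := (summable_smul_X_pow p.summable_norm_coeff).hasSum
  convert h using 1
  ext k
  have h1 := (coeffL k).hasSum h
  have h2 : HasSum (fun n => coeffL k (p.coeff n • X ^ n)) (p.coeff k) := by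
    convert hasSum_ite_eq k (p.coeff k) using 2 with n
    change (p.coeff n • X ^ n).coeff k = _
    rw [coeff_smul, coeff_X_pow]
    by_cases hn : k = n
    · simp [hn]
    · simp [hn, Ne.symm hn]
  exact h2.unique h1

/-- Evaluation of the series. -/
def ev (z : ℂ) (p : AbsSeries) : ℂ := ∑' n, p.coeff n * z ^ n

theorem summable_norm_ev {z : ℂ} (hz : ‖z‖ ≤ 1) (p : AbsSeries) :
    Summable fun n => ‖p.coeff n * z ^ n‖ :=
  Summable.of_nonneg_of_le (fun _ => norm_nonneg _) (fun n => by
    rw [norm_mul, norm_pow]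
    exact mul_le_of_le_one_right (norm_nonneg _) (pow_le_one₀ (norm_nonneg _) hz))
    p.summable_norm_coeff

theorem hasSum_ev {z : ℂ} (hz : ‖z‖ ≤ 1) (p : AbsSeries) :
    HasSum (fun n => p.coeff n * z ^ n) (ev z p) :=
  (summable_norm_ev hz p).of_norm.hasSum

theorem norm_ev_le {z : ℂ} (hz : ‖z‖ ≤ 1) (p : AbsSeries) : ‖ev z p‖ ≤ ‖p‖ := by
  refine (norm_tsum_le_tsum_norm (summable_norm_ev hz p)).trans ?_
  refine (summable_norm_ev hz p).tsum_le_tsum (fun n => ?_) p.summable_norm_coeff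
  rw [norm_mul, norm_pow]
  exact mul_le_of_le_one_right (norm_nonneg _) (pow_le_one₀ (norm_nonneg _) hz)

/-- Evaluation at a point of the closed disc, as an algebra homomorphism. -/
def evHom {z : ℂ} (hz : ‖z‖ ≤ 1) : AbsSeries →ₐ[ℂ] ℂ where
  toFun := ev z
  map_one' := by
    rw [ev, tsum_eq_single 0]
    · simp [coeff_one]
    · intro n hn
      simp [coeff_one, hn]
  map_mul' p q := by
    rw [ev, ev, ev, tsum_mul_tsum_eq_tsum_sum_antidiagonal_of_summable_norm
      (summable_norm_ev hz p) (summable_norm_ev hz q)]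
    refine tsum_congr fun n => ?_
    rw [coeff_mul, Finset.sum_mul]
    refine Finset.sum_congr rfl fun kl hkl => ?_
    rw [← Finset.HasAntidiagonal.mem_antidiagonal.mp hkl, pow_add]
    ring
  map_zero' := by simp [ev]
  map_add' p q := by
    simp only [ev, coeff_add, add_mul]
    exact (hasSum_ev hz p).summable.tsum_add (hasSum_ev hz q).summable
  commutes' c := by
    rw [Algebra.algebraMap_eq_smul_one, ev, tsum_eq_single 0]
    · simp [coeff_one]
    · intro n hn
      simp [coeff_one, hn]

@[simp] theorem evHom_apply {z : ℂ} (hz : ‖z‖ ≤ 1) (p : AbsSeries) : evHom hz p = ev z p := rfl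

/-- Evaluation at a point of the closed disc is continuous. -/
def evL {z : ℂ} (hz : ‖z‖ ≤ 1) : AbsSeries →L[ℂ] ℂ :=
  LinearMap.mkContinuous (evHom hz).toLinearMap 1 fun p => by simpa using norm_ev_le hz p

theorem ev_mul {z : ℂ} (hz : ‖z‖ ≤ 1) (p q : AbsSeries) : ev z (p * q) = ev z p * ev z q :=
  map_mul (evHom hz) p q

theorem ev_sub {z : ℂ} (hz : ‖z‖ ≤ 1) (p q : AbsSeries) : ev z (p - q) = ev z p - ev z q :=
  map_sub (evHom hz) p q

theorem ev_X (z : ℂ) : ev z X = z := by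
  rw [ev, tsum_eq_single 1]
  · have := coeff_X_pow 1 1
    rw [pow_one] at this
    simp [this]
  · intro n hn
    have := coeff_X_pow 1 n
    rw [pow_one] at this
    simp [this, hn]

theorem continuousOn_ev (p : AbsSeries) : ContinuousOn (fun z => ev z p) (closedBall 0 1) := by
  refine continuousOn_tsum (fun n => by fun_prop) p.summable_norm_coeff fun n z hz => ?_
  rw [norm_mul, norm_pow]
  exact mul_le_of_le_one_right (norm_nonneg _) (pow_le_one₀ (norm_nonneg _) (by simpa using hz))

theorem differentiableOn_ev (p : AbsSeries) : DifferentiableOn ℂ (fun z => ev z p) (ball 0 1) := by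
  refine differentiableOn_tsum_of_summable_norm p.summable_norm_coeff (fun n => by fun_prop)
    isOpen_ball fun n z hz => ?_
  rw [norm_mul, norm_pow]
  exact mul_le_of_le_one_right (norm_nonneg _)
    (pow_le_one₀ (norm_nonneg _) (by simpa using (mem_ball_zero_iff.mp hz).le))

/-- Division with remainder by `X - z`. -/
theorem exists_div {z : ℂ} (hz : ‖z‖ < 1) (p : AbsSeries) :
    ∃ q : AbsSeries, p - algebraMap ℂ _ (ev z p) = (X - algebraMap ℂ _ z) * q ∧
      ‖q‖ ≤ ‖p‖ / (1 - ‖z‖) := by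
  have hz1 : 0 < 1 - ‖z‖ := by linarith
  set Z : AbsSeries := algebraMap ℂ _ z with hZ
  have hZn : ‖Z‖ = ‖z‖ := by rw [hZ, norm_algebraMap']
  set s : ℕ → AbsSeries := fun n => ∑ j ∈ Finset.range n, X ^ j * Z ^ (n - 1 - j) with hs
  have hsn : ∀ n, ‖s n‖ ≤ (1 - ‖z‖)⁻¹ := by
    intro n
    calc ‖s n‖ ≤ ∑ j ∈ Finset.range n, ‖z‖ ^ (n - 1 - j) := by
          refine (norm_sum_le _ _).trans (Finset.sum_le_sum fun j _ => ?_)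
          refine (norm_mul_le _ _).trans ?_
          rw [norm_X_pow, one_mul]
          exact (norm_pow_le _ _).trans (by rw [hZn])
      _ = ∑ j ∈ Finset.range n, ‖z‖ ^ j := Finset.sum_range_reflect (fun j => ‖z‖ ^ j) n
      _ ≤ ∑' j, ‖z‖ ^ j := (summable_geometric_of_lt_one (norm_nonneg _) hz).sum_le_tsum _
          fun _ _ => by positivity
      _ = _ := tsum_geometric_of_lt_one (norm_nonneg _) hz
  have hbd : ∀ n, ‖p.coeff n • s n‖ ≤ ‖p.coeff n‖ * (1 - ‖z‖)⁻¹ := fun n => by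
    rw [norm_smul]
    gcongr
    exact hsn n
  have hsum : Summable fun n => p.coeff n • s n :=
    Summable.of_norm_bounded (p.summable_norm_coeff.mul_right _) hbd
  refine ⟨∑' n, p.coeff n • s n, ?_, ?_⟩
  · have h1 : HasSum (fun n => (X - Z) * (p.coeff n • s n)) ((X - Z) * ∑' n, p.coeff n • s n) :=
      hsum.hasSum.mul_left _
    have h2 : HasSum (fun n => p.coeff n • X ^ n - algebraMap ℂ AbsSeries (p.coeff n * z ^ n))
        (p - algebraMap ℂ _ (ev z p)) := by
      refine (hasSum_X_pow p).sub ?_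
      exact (hasSum_ev hz.le p).map (algebraMap ℂ AbsSeries) (algebraMapCLM ℂ AbsSeries).continuous
    refine h2.unique ?_
    convert h1 using 2 with n
    rw [mul_smul_comm, hs, mul_comm (X - Z), (Commute.all X Z).geom_sum₂_mul n, smul_sub, map_mul,
      map_pow, ← Algebra.smul_def]
  · rw [div_eq_mul_inv]
    exact tsum_of_norm_bounded ((hasSum_norm p).mul_right _) hbd

/-- Polynomials are dense. -/
theorem exists_polynomial_near (p : AbsSeries) {ε : ℝ} (hε : 0 < ε) :
    ∃ P : Polynomial ℂ, ‖p - Polynomial.aeval X P‖ < ε := by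
  have h := (hasSum_X_pow p).tendsto_sum_nat
  obtain ⟨N, hN⟩ := ((tendsto_order.mp (tendsto_iff_norm_sub_tendsto_zero.mp h)).2 ε hε).exists
  refine ⟨∑ n ∈ Finset.range N, Polynomial.C (p.coeff n) * Polynomial.X ^ n, ?_⟩
  have hP : Polynomial.aeval X
      (∑ n ∈ Finset.range N, Polynomial.C (p.coeff n) * Polynomial.X ^ n) =
      ∑ n ∈ Finset.range N, p.coeff n • X ^ n := by
    rw [map_sum]
    simp [Algebra.smul_def]
  rw [norm_sub_rev, hP]
  exact hN

end AbsSeries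

namespace AbsSeries

/-- The common zeros, in the closed disc, of the elements of an ideal. -/
def zeros (J : Ideal AbsSeries) : Set ℂ := {z | ‖z‖ ≤ 1 ∧ ∀ g ∈ J, ev z g = 0}

/-- The ideal of those `g` with `f * g ∈ I`. -/
def divIdeal (I : Ideal AbsSeries) (f : AbsSeries) : Ideal AbsSeries :=
  Submodule.comap (LinearMap.mulLeft AbsSeries f) I

theorem mem_divIdeal {I : Ideal AbsSeries} {f g : AbsSeries} : g ∈ divIdeal I f ↔ f * g ∈ I :=
  Iff.rfl

theorem le_divIdeal (I : Ideal AbsSeries) (f : AbsSeries) : I ≤ divIdeal I f :=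
  fun _ hg => I.mul_mem_left f hg

theorem isClosed_divIdeal (I : Ideal AbsSeries) [hI : IsClosed (I : Set AbsSeries)]
    (f : AbsSeries) : IsClosed (divIdeal I f : Set AbsSeries) :=
  hI.preimage (continuous_const_mul f)

/-- The quotient map as a continuous linear map. -/
def mkL (J : Ideal AbsSeries) [IsClosed (J : Set AbsSeries)] : AbsSeries →L[ℂ] AbsSeries ⧸ J :=
  LinearMap.mkContinuous (Ideal.Quotient.mkₐ ℂ J).toLinearMap 1 fun p => by
    simpa using Ideal.Quotient.norm_mk_le J p

theorem mkL_apply (J : Ideal AbsSeries) [IsClosed (J : Set AbsSeries)] (p : AbsSeries) :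
    mkL J p = Ideal.Quotient.mk J p := rfl

theorem norm_mkL_le (J : Ideal AbsSeries) [IsClosed (J : Set AbsSeries)] (p : AbsSeries) :
    ‖mkL J p‖ ≤ ‖p‖ := Ideal.Quotient.norm_mk_le J p

theorem spectrum_subset_zeros (J : Ideal AbsSeries) [IsClosed (J : Set AbsSeries)] :
    spectrum ℂ (Ideal.Quotient.mk J X) ⊆ zeros J := by
  intro z hz
  have hz1 : ‖z‖ ≤ 1 := by
    refine (spectrum.norm_le_norm_mul_of_mem hz).trans ?_
    have h1 := Ideal.Quotient.norm_mk_le J X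
    have h2 := Ideal.Quotient.norm_mk_le J 1
    rw [norm_X] at h1
    rw [norm_one, map_one] at h2
    exact mul_le_one₀ h1 (norm_nonneg _) h2
  obtain ⟨χ, hχ⟩ := WeakDual.CharacterSpace.mem_spectrum_iff_exists.mp hz
  have hχc : Continuous fun p => χ (mkL J p) :=
    (map_continuous χ).comp (mkL J).continuous
  have hev : ∀ p, χ (mkL J p) = ev z p := by
    intro p
    have h1 := (hasSum_X_pow p).map
      ((AlgHomClass.toAlgHom χ : (AbsSeries ⧸ J) →ₐ[ℂ] ℂ).comp (Ideal.Quotient.mkₐ ℂ J)) hχc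
    refine h1.unique ?_
    convert hasSum_ev hz1 p using 2 with n
    simp only [Function.comp_apply, map_smul, map_pow, smul_eq_mul]
    congr 2
  refine ⟨hz1, fun g hg => ?_⟩
  rw [← hev, mkL_apply, Ideal.Quotient.eq_zero_iff_mem.mpr hg, map_zero]

theorem resolvent_mk_eq {J : Ideal AbsSeries} {z : ℂ} {r : AbsSeries}
    (h : 1 - (algebraMap ℂ _ z - X) * r ∈ J) :
    resolvent (Ideal.Quotient.mk J X) z = Ideal.Quotient.mk J r := by
  have h1 :
      (algebraMap ℂ (AbsSeries ⧸ J) z - Ideal.Quotient.mk J X) * Ideal.Quotient.mk J r = 1 := by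
    have := Ideal.Quotient.eq_zero_iff_mem.mpr h
    rw [map_sub, map_mul, map_sub, map_one, sub_eq_zero] at this
    exact this.symm
  exact Ring.inverse_unit (Units.mkOfMulEqOne _ _ h1)

theorem differentiableAt_resolvent {J : Ideal AbsSeries} [IsClosed (J : Set AbsSeries)] {z : ℂ}
    (hz : z ∉ zeros J) : DifferentiableAt ℂ (resolvent (Ideal.Quotient.mk J X)) z := by
  have hz' : z ∈ resolventSet ℂ (Ideal.Quotient.mk J X) := by
    by_contra hcon
    exact hz (spectrum_subset_zeros J hcon)
  exact (spectrum.hasDerivAt_resolvent_const_left hz').differentiableAt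

/-- Multiplication by `f` from `A / I(f)` to `A / I`. -/
def quotMul (I : Ideal AbsSeries) (f : AbsSeries) :
    (AbsSeries ⧸ divIdeal I f) →ₗ[AbsSeries] AbsSeries ⧸ I :=
  Submodule.mapQ (divIdeal I f) I (LinearMap.mulLeft AbsSeries f) le_rfl

theorem quotMul_mk (I : Ideal AbsSeries) (f p : AbsSeries) :
    quotMul I f (Ideal.Quotient.mk _ p) = Ideal.Quotient.mk I (f * p) := rfl

theorem quotMul_injective (I : Ideal AbsSeries) (f : AbsSeries) :
    Function.Injective (quotMul I f) := by
  rw [injective_iff_map_eq_zero]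
  intro x hx
  obtain ⟨p, rfl⟩ := Ideal.Quotient.mk_surjective x
  rw [quotMul_mk, Ideal.Quotient.eq_zero_iff_mem] at hx
  exact Ideal.Quotient.eq_zero_iff_mem.mpr hx

section

variable (I : Ideal AbsSeries) [IsClosed (I : Set AbsSeries)] (f : AbsSeries)
  [IsClosed (divIdeal I f : Set AbsSeries)]

theorem norm_quotMul_le (x : AbsSeries ⧸ divIdeal I f) :
    ‖quotMul I f x‖ ≤ ‖f‖ * ‖x‖ := by
  apply le_of_forall_pos_le_add
  intro ε hε
  obtain ⟨p, rfl, hp⟩ := Ideal.Quotient.norm_mk_lt x (ε := ε / (‖f‖ + 1)) (by positivity)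
  rw [quotMul_mk]
  refine (Ideal.Quotient.norm_mk_le I _).trans ((norm_mul_le _ _).trans ?_)
  calc ‖f‖ * ‖p‖ ≤ ‖f‖ * (‖Ideal.Quotient.mk (divIdeal I f) p‖ + ε / (‖f‖ + 1)) := by gcongr
    _ = ‖f‖ * ‖Ideal.Quotient.mk (divIdeal I f) p‖ + ‖f‖ / (‖f‖ + 1) * ε := by ring
    _ ≤ _ := by
      gcongr
      refine mul_le_of_le_one_left hε.le ?_
      rw [div_le_one (by positivity)]
      linarith

/-- `quotMul` as a continuous linear map. -/
def quotMulL : (AbsSeries ⧸ divIdeal I f) →L[ℂ] AbsSeries ⧸ I :=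
  LinearMap.mkContinuous ((quotMul I f).restrictScalars ℂ) ‖f‖ (norm_quotMul_le I f)

theorem quotMulL_apply (x : AbsSeries ⧸ divIdeal I f) : quotMulL I f x = quotMul I f x := rfl

/-- The Cauchy transform of a functional on `A / I`, moved to `A / I(f)`. -/
def cauchyTransform (φ : (AbsSeries ⧸ I) →L[ℂ] ℂ) (z : ℂ) : ℂ :=
  φ (quotMulL I f (resolvent (Ideal.Quotient.mk (divIdeal I f) X) z))

variable {I f}

theorem cauchyTransform_eq (φ : (AbsSeries ⧸ I) →L[ℂ] ℂ) {z : ℂ} {r : AbsSeries}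
    (h : 1 - (algebraMap ℂ _ z - X) * r ∈ divIdeal I f) :
    cauchyTransform I f φ z = φ (mkL I (f * r)) := by
  rw [cauchyTransform, resolvent_mk_eq h, quotMulL_apply, quotMul_mk, mkL_apply]

theorem differentiableAt_cauchyTransform (φ : (AbsSeries ⧸ I) →L[ℂ] ℂ) {z : ℂ}
    (hz : z ∉ zeros (divIdeal I f)) : DifferentiableAt ℂ (cauchyTransform I f φ) z :=
  (φ.differentiableAt.comp _ (quotMulL I f).differentiableAt).comp z (differentiableAt_resolvent hz)

theorem exists_resolvent_of_one_lt {z : ℂ} (hz : 1 < ‖z‖) :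
    ∃ r : AbsSeries, (algebraMap ℂ _ z - X) * r = 1 ∧ ‖r‖ ≤ 1 / (‖z‖ - 1) := by
  have h1 : z ∈ resolventSet ℂ (X : AbsSeries) := by
    apply spectrum.mem_resolventSet_of_norm_lt
    rwa [norm_X]
  obtain ⟨u, hu⟩ : IsUnit (algebraMap ℂ AbsSeries z - X) := h1
  have h2 : (algebraMap ℂ AbsSeries z - X) * (↑u⁻¹ : AbsSeries) = 1 := by
    rw [← hu, Units.mul_inv]
  refine ⟨↑u⁻¹, h2, ?_⟩
  generalize (↑u⁻¹ : AbsSeries) = r at h2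
  rw [le_div_iff₀ (by linarith)]
  have h3 : z • r = 1 + X * r := by
    rw [Algebra.smul_def, ← h2]
    ring
  have h4 : ‖z‖ * ‖r‖ ≤ 1 + ‖r‖ := by
    rw [← norm_smul, h3]
    refine (norm_add_le _ _).trans ?_
    rw [norm_one]
    gcongr
    refine (norm_mul_le _ _).trans ?_
    rw [norm_X, one_mul]
  linarith

theorem norm_cauchyTransform_le (φ : (AbsSeries ⧸ I) →L[ℂ] ℂ) {z : ℂ} (hz : 1 < ‖z‖) :
    ‖cauchyTransform I f φ z‖ ≤ ‖φ‖ * ‖f‖ / (‖z‖ - 1) := by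
  obtain ⟨r, hr, hrn⟩ := exists_resolvent_of_one_lt hz
  rw [cauchyTransform_eq φ (r := r) (by rw [hr, sub_self]; exact zero_mem _)]
  calc _ ≤ ‖φ‖ * ‖f * r‖ := (φ.le_opNorm _).trans (by gcongr; exact norm_mkL_le _ _)
    _ ≤ ‖φ‖ * (‖f‖ * (1 / (‖z‖ - 1))) := by
      gcongr
      exact (norm_mul_le _ _).trans (by gcongr)
    _ = _ := by ring

theorem tendsto_cauchyTransform (φ : (AbsSeries ⧸ I) →L[ℂ] ℂ) {ζ : ℂ} (hζ : ‖ζ‖ = 1)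
    (hf : ev ζ f = 0) :
    Tendsto (fun t : ℝ => ((t : ℂ) - 1) * cauchyTransform I f φ (t * ζ)) (nhdsWithin 1 (Ioi 1))
      (nhds 0) := by
  have key : ∀ ε > 0, ∃ Q : AbsSeries, ‖f - (X - algebraMap ℂ _ ζ) * Q‖ ≤ ε := by
    intro ε hε
    obtain ⟨P, hP⟩ := exists_polynomial_near f (half_pos hε)
    have h1 : (Polynomial.X - Polynomial.C ζ) ∣ P - Polynomial.C (P.eval ζ) :=
      Polynomial.X_sub_C_dvd_sub_C_eval
    obtain ⟨R, hR⟩ := h1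
    refine ⟨Polynomial.aeval X R, ?_⟩
    have h2 := congrArg (Polynomial.aeval (X : AbsSeries)) hR
    simp only [map_sub, map_mul, Polynomial.aeval_X, Polynomial.aeval_C] at h2
    rw [← h2]
    have h3 : ev ζ (Polynomial.aeval X P) = P.eval ζ := by
      rw [← evHom_apply hζ.le, ← Polynomial.aeval_algHom_apply, evHom_apply, ev_X,
        Polynomial.coe_aeval_eq_eval]
    have h4 : ‖P.eval ζ‖ ≤ ‖f - Polynomial.aeval X P‖ := by
      have := norm_ev_le hζ.le (f - Polynomial.aeval X P)
      rwa [ev_sub hζ.le, hf, h3, zero_sub, norm_neg] at this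
    calc _ = ‖(f - Polynomial.aeval X P) + algebraMap ℂ AbsSeries (P.eval ζ)‖ := by
          congr 1
          ring
      _ ≤ _ := (norm_add_le _ _)
      _ ≤ ε / 2 + ε / 2 := by
          rw [norm_algebraMap']
          linarith
      _ = ε := by ring
  have hbound : ∀ Q : AbsSeries, ∀ t : ℝ, 1 < t →
      ‖((t : ℂ) - 1) * cauchyTransform I f φ (t * ζ)‖ ≤
      ‖φ‖ * (2 * ‖Q‖ * (t - 1) + ‖f - (X - algebraMap ℂ _ ζ) * Q‖) := by
    intro Q t ht
    have hn : ‖(t : ℂ) * ζ‖ = t := by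
      rw [norm_mul, hζ, mul_one, norm_real, Real.norm_of_nonneg (by linarith)]
    obtain ⟨r, hr, hrn⟩ := exists_resolvent_of_one_lt (z := t * ζ) (by rw [hn]; exact ht)
    rw [hn] at hrn
    rw [cauchyTransform_eq φ (r := r) (by rw [hr, sub_self]; exact zero_mem _)]
    have ht1 : 0 < t - 1 := by linarith
    have hd : ‖(t : ℂ) - 1‖ = t - 1 := by
      rw [← ofReal_one, ← ofReal_sub, norm_real, Real.norm_of_nonneg ht1.le]
    rw [norm_mul, hd]
    set E := f - (X - algebraMap ℂ _ ζ) * Q with hE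
    have h1 : f * r = Q * ((((t : ℂ) - 1) * ζ) • r - 1) + E * r := by
      rw [hE, Algebra.smul_def, ← hr]
      simp only [map_mul, map_sub, map_one]
      ring
    have h2 : ‖(((t : ℂ) - 1) * ζ) • r - 1‖ ≤ 2 := by
      refine (norm_sub_le _ _).trans ?_
      rw [norm_smul, norm_mul, hd, hζ, mul_one, norm_one]
      have : (t - 1) * ‖r‖ ≤ (t - 1) * (1 / (t - 1)) := by gcongr
      rw [mul_one_div_cancel ht1.ne'] at this
      linarith
    have h3 : ‖f * r‖ ≤ ‖Q‖ * 2 + ‖E‖ * (1 / (t - 1)) := by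
      rw [h1]
      refine (norm_add_le _ _).trans (add_le_add ?_ ?_)
      · exact (norm_mul_le _ _).trans (by gcongr)
      · exact (norm_mul_le _ _).trans (by gcongr)
    calc (t - 1) * ‖φ (mkL I (f * r))‖ ≤ (t - 1) * (‖φ‖ * (‖Q‖ * 2 + ‖E‖ * (1 / (t - 1)))) := by
          gcongr
          refine (φ.le_opNorm _).trans ?_
          gcongr
          exact (norm_mkL_le _ _).trans h3
      _ = _ := by
          field_simp
  rw [Metric.tendsto_nhdsWithin_nhds]
  intro ε hε
  obtain ⟨Q, hQ⟩ := key (ε / (2 * (‖φ‖ + 1))) (by positivity)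
  refine ⟨ε / (4 * (‖φ‖ + 1) * (‖Q‖ + 1)), by positivity, fun {t} ht htd => ?_⟩
  rw [dist_zero_right]
  rw [Real.dist_eq, abs_of_pos (by simpa using ht), lt_div_iff₀ (by positivity)] at htd
  rw [le_div_iff₀ (by positivity)] at hQ
  have ht' : 1 < t := ht
  refine (hbound Q t ht').trans_lt ?_
  have hφ : 0 ≤ ‖φ‖ := φ.opNorm_nonneg
  have hQ0 : 0 ≤ ‖Q‖ := norm_nonneg _
  have hE0 : 0 ≤ ‖f - (X - algebraMap ℂ _ ζ) * Q‖ := norm_nonneg _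
  generalize ‖f - (X - algebraMap ℂ _ ζ) * Q‖ = e at *
  generalize ‖Q‖ = q at *
  generalize ‖φ‖ = c at *
  have hs : 0 < t - 1 := by linarith
  generalize t - 1 = s at *
  nlinarith [mul_nonneg hφ hs.le, mul_nonneg (mul_nonneg hφ hs.le) hQ0, mul_nonneg hs.le hQ0,
    mul_nonneg hφ hE0]

theorem norm_cauchyTransform_mul_le (φ : (AbsSeries ⧸ I) →L[ℂ] ℂ) {h : AbsSeries} (hh : h ∈ I)
    {z : ℂ} (hz : ‖z‖ < 1) :
    ‖cauchyTransform I f φ z * ev z h‖ ≤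
      ‖φ‖ * (‖ev z f‖ * ‖h‖ + ‖ev z h‖ * ‖f‖) / (1 - ‖z‖) := by
  have hz1 : 0 < 1 - ‖z‖ := by linarith
  by_cases hhz : ev z h = 0
  · rw [hhz]
    simp only [mul_zero, norm_zero]
    positivity
  obtain ⟨k, hk, hkn⟩ := exists_div hz f
  obtain ⟨g, hg, hgn⟩ := exists_div hz h
  have hr : 1 - (algebraMap ℂ _ z - X) * ((ev z h)⁻¹ • g) ∈ divIdeal I f := by
    have : 1 - (algebraMap ℂ _ z - X) * ((ev z h)⁻¹ • g) = (ev z h)⁻¹ • h := by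
      have h1 : (algebraMap ℂ _ z - X) * g = algebraMap ℂ _ (ev z h) - h := by
        linear_combination hg
      rw [mul_smul_comm, h1, smul_sub, Algebra.algebraMap_eq_smul_one, smul_smul,
        inv_mul_cancel₀ hhz, one_smul]
      ring
    rw [this]
    exact Submodule.smul_of_tower_mem _ _ (le_divIdeal I f hh)
  rw [cauchyTransform_eq φ hr]
  have h2 : f * ((ev z h)⁻¹ • g) = (ev z h)⁻¹ • (ev z f • g + k * h) - k := by
    have h3 : f * g = ev z f • g + k * h - (ev z h) • k := by
      rw [Algebra.smul_def, Algebra.smul_def]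
      linear_combination g * hk - k * hg
    rw [mul_smul_comm, h3, smul_sub, smul_smul, inv_mul_cancel₀ hhz, one_smul]
  have h4 : φ (mkL I (f * ((ev z h)⁻¹ • g))) * ev z h =
      ev z f * φ (mkL I g) - ev z h * φ (mkL I k) := by
    have h5 : mkL I (k * h) = 0 := by
      rw [mkL_apply, Ideal.Quotient.eq_zero_iff_mem]
      exact I.mul_mem_left k hh
    rw [h2, map_sub, map_smul, map_add, map_smul, h5, add_zero, map_sub, map_smul, map_smul]
    simp only [smul_eq_mul]
    field_simp
  rw [h4]
  calc _ ≤ ‖ev z f‖ * (‖φ‖ * (‖h‖ / (1 - ‖z‖))) + ‖ev z h‖ * (‖φ‖ * (‖f‖ / (1 - ‖z‖))) := by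
        refine (norm_sub_le _ _).trans ?_
        rw [norm_mul, norm_mul]
        gcongr
        · refine (φ.le_opNorm _).trans ?_
          gcongr
          exact (norm_mkL_le _ _).trans hgn
        · refine (φ.le_opNorm _).trans ?_
          gcongr
          exact (norm_mkL_le _ _).trans hkn
    _ = _ := by ring

theorem circleIntegral_apply {B Y : Type*} [NormedAddCommGroup B] [NormedSpace ℂ B]
    [CompleteSpace B] [NormedAddCommGroup Y] [NormedSpace ℂ Y] [CompleteSpace Y]
    (L : B →L[ℂ] Y) {R : ℂ → B} {ζ : ℂ} {r : ℝ} (hR : CircleIntegrable R ζ r) :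
    (∮ z in C(ζ, r), L (R z)) = L (∮ z in C(ζ, r), R z) := by
  rw [circleIntegral, circleIntegral, ← L.intervalIntegral_comp_comm hR.out]
  simp

/-- If all Cauchy transforms have vanishing integral around a circle, then the centre of the circle
is not a zero. -/
theorem false_of_circleIntegral_eq_zero {ζ : ℂ} {r : ℝ} (hr : 0 < r)
    (hζ : ζ ∈ zeros (divIdeal I f)) (hs : ∀ z ∈ sphere ζ r, z ∉ zeros (divIdeal I f))
    (h0 : ∀ φ : (AbsSeries ⧸ I) →L[ℂ] ℂ, (∮ z in C(ζ, r), cauchyTransform I f φ z) = 0) :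
    False := by
  have hRint : CircleIntegrable (resolvent (Ideal.Quotient.mk (divIdeal I f) X)) ζ r := by
    apply ContinuousOn.circleIntegrable hr.le
    exact fun z hz => (differentiableAt_resolvent (hs z hz)).continuousAt.continuousWithinAt
  have he : (∮ z in C(ζ, r), resolvent (Ideal.Quotient.mk (divIdeal I f) X) z) = 0 := by
    by_contra hne
    have h1 : quotMulL I f
        (∮ z in C(ζ, r), resolvent (Ideal.Quotient.mk (divIdeal I f) X) z) ≠ 0 := by
      rw [quotMulL_apply]
      exact fun h => hne ((injective_iff_map_eq_zero _).mp (quotMul_injective I f) _ h)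
    obtain ⟨φ, hφ⟩ := SeparatingDual.exists_ne_zero (R := ℂ) h1
    apply hφ
    have h2 := circleIntegral_apply (φ.comp (quotMulL I f)) hRint
    rw [ContinuousLinearMap.comp_apply] at h2
    rw [← h2]
    exact h0 φ
  obtain ⟨hζ1, hζ0⟩ := hζ
  set χ : (AbsSeries ⧸ divIdeal I f) →ₐ[ℂ] ℂ :=
    Ideal.Quotient.liftₐ (divIdeal I f) (evHom hζ1) hζ0 with hχ
  have hχX : χ (Ideal.Quotient.mk _ X) = ζ := ev_X ζ
  have h3 := circleIntegral_apply χ.toContinuousLinearMap hRint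
  rw [he, map_zero] at h3
  have h4 : (∮ z in C(ζ, r), χ (resolvent (Ideal.Quotient.mk (divIdeal I f) X) z)) =
      ∮ z in C(ζ, r), (z - ζ)⁻¹ := by
    apply circleIntegral.integral_congr hr.le
    intro z hz
    have h5 : z ∈ resolventSet ℂ (Ideal.Quotient.mk (divIdeal I f) X) := by
      by_contra hcon
      exact hs z hz (spectrum_subset_zeros _ hcon)
    have h6 := congrArg χ (Ring.mul_inverse_cancel _ h5)
    rw [map_mul, map_sub, hχX, AlgHomClass.commutes, map_one] at h6
    exact eq_inv_of_mul_eq_one_right h6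
  have h7 : (∮ z in C(ζ, r), χ (resolvent (Ideal.Quotient.mk (divIdeal I f) X) z)) = 0 := h3
  rw [h4, circleIntegral.integral_sub_center_inv ζ hr.ne'] at h7
  simp [Real.pi_ne_zero] at h7

end

end AbsSeries

theorem one_sub_conj_mul_ne_zero {a z : ℂ} (ha : ‖a‖ < 1) (hz : ‖z‖ ≤ 1) :
    1 - (starRingEnd ℂ) a * z ≠ 0 := by
  intro h
  have h1 : ‖(starRingEnd ℂ) a * z‖ = 1 := by
    rw [← sub_eq_zero.mp h, norm_one]
  rw [norm_mul, RCLike.norm_conj] at h1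
  nlinarith [norm_nonneg a, norm_nonneg z]

theorem norm_sub_sq_add (a z : ℂ) :
    ‖1 - (starRingEnd ℂ) a * z‖ ^ 2 - ‖z - a‖ ^ 2 = (1 - ‖a‖ ^ 2) * (1 - ‖z‖ ^ 2) := by
  simp only [← Complex.normSq_eq_norm_sq, Complex.normSq_apply]
  simp
  ring

/-- A bounded holomorphic function with unimodular radial limits everywhere along radii ending at
points of continuity is inner. -/
theorem isInnerFunction_of_continuousAt {u : ℂ → ℂ} (hu : DifferentiableOn ℂ u (ball 0 1))
    (hu1 : ∀ z ∈ ball (0 : ℂ) 1, ‖u z‖ ≤ 1)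
    (hb : ∀ᵐ θ : ℝ, ContinuousAt u (Complex.exp (θ * Complex.I)) ∧
      ‖u (Complex.exp (θ * Complex.I))‖ = 1) :
    IsInnerFunction u := by
  refine ⟨hu, hu1, ae_restrict_of_ae ?_⟩
  filter_upwards [hb] with θ hθ
  have h1 : Tendsto (fun r : ℝ => (r : ℂ) * Complex.exp (θ * Complex.I)) (nhdsWithin 1 (Iio 1))
      (nhds (Complex.exp (θ * Complex.I))) := by
    have : Continuous fun r : ℝ => (r : ℂ) * Complex.exp (θ * Complex.I) := by fun_prop
    have h2 := this.tendsto 1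
    simp only [ofReal_one, one_mul] at h2
    exact h2.mono_left nhdsWithin_le_nhds
  have h2 := (hθ.1.tendsto.comp h1).norm
  rw [hθ.2] at h2
  exact h2

theorem isInnerFunction_blaschke_pow {a : ℂ} (ha : ‖a‖ < 1) (m : ℕ) :
    IsInnerFunction fun z => ((z - a) / (1 - (starRingEnd ℂ) a * z)) ^ m := by
  have hd : ∀ z : ℂ, ‖z‖ ≤ 1 →
      DifferentiableAt ℂ (fun z => ((z - a) / (1 - (starRingEnd ℂ) a * z)) ^ m) z := fun z hz => by
    have := one_sub_conj_mul_ne_zero ha hz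
    fun_prop (disch := assumption)
  refine isInnerFunction_of_continuousAt
    (fun z hz => (hd z (mem_ball_zero_iff.mp hz).le).differentiableWithinAt)
    (fun z hz => ?_) (Eventually.of_forall fun θ => ?_)
  · have hz1 : ‖z‖ < 1 := mem_ball_zero_iff.mp hz
    rw [norm_pow, norm_div]
    apply pow_le_one₀ (by positivity)
    rw [div_le_one (norm_pos_iff.mpr (one_sub_conj_mul_ne_zero ha hz1.le))]
    have h1 := norm_sub_sq_add a z
    have h2 : 0 ≤ (1 - ‖a‖ ^ 2) * (1 - ‖z‖ ^ 2) :=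
      mul_nonneg (by nlinarith [norm_nonneg a]) (by nlinarith [norm_nonneg z])
    exact le_of_sq_le_sq (by linarith) (norm_nonneg _)
  · have hn : ‖Complex.exp (θ * Complex.I)‖ = 1 := norm_exp_ofReal_mul_I θ
    refine ⟨(hd _ hn.le).continuousAt, ?_⟩
    have h1 := norm_sub_sq_add a (Complex.exp (θ * Complex.I))
    rw [hn] at h1
    have h2 : ‖Complex.exp (θ * Complex.I) - a‖ =
        ‖1 - (starRingEnd ℂ) a * Complex.exp (θ * Complex.I)‖ :=
      (pow_left_inj₀ (norm_nonneg _) (norm_nonneg _) two_ne_zero).mp (by linarith)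
    rw [norm_pow, norm_div, h2, div_self, one_pow]
    exact norm_ne_zero_iff.mpr (one_sub_conj_mul_ne_zero ha hn.le)

namespace AbsSeries

theorem ev_pow_mul {z : ℂ} (hz : ‖z‖ ≤ 1) (a : ℂ) (m : ℕ) (k : AbsSeries) :
    ev z ((X - algebraMap ℂ _ a) ^ m * k) = (z - a) ^ m * ev z k := by
  have h : evHom hz ((X - algebraMap ℂ _ a) ^ m * k) = (z - a) ^ m * ev z k := by
    rw [map_mul, map_pow, map_sub, AlgHom.commutes, evHom_apply, evHom_apply, ev_X]
    rfl
  exact h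

theorem exists_eq_mul_of_ev_eq_zero {a : ℂ} (ha : ‖a‖ < 1) {p : AbsSeries} (hp : ev a p = 0) :
    ∃ q, p = (X - algebraMap ℂ _ a) * q := by
  obtain ⟨q, hq, -⟩ := exists_div ha p
  rw [hp, map_zero, sub_zero] at hq
  exact ⟨q, hq⟩

theorem hasFPowerSeriesAt_of_eqOn {p : AbsSeries} {f : ℂ → ℂ}
    (hf : ∀ z ∈ ball (0 : ℂ) 1, f z = ev z p) :
    HasFPowerSeriesAt f (FormalMultilinearSeries.ofScalars ℂ p.coeff) 0 := by
  rw [hasFPowerSeriesAt_iff]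
  filter_upwards [ball_mem_nhds (0 : ℂ) one_pos] with z hz
  rw [zero_add, hf z hz]
  simp only [FormalMultilinearSeries.coeff_ofScalars, smul_eq_mul]
  simp only [mul_comm (z ^ _)]
  exact hasSum_ev (mem_ball_zero_iff.mp hz).le p

theorem taylorCoeff_eq {p : AbsSeries} {f : ℂ → ℂ} (hf : ∀ z ∈ ball (0 : ℂ) 1, f z = ev z p)
    (n : ℕ) : taylorCoeff f n = p.coeff n := by
  have h1 := hasFPowerSeriesAt_of_eqOn hf
  have h2 := h1.analyticAt.hasFPowerSeriesAt
  have h3 := congrArg (fun s => FormalMultilinearSeries.coeff s n)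
    (h2.eq_formalMultilinearSeries h1)
  simp only [FormalMultilinearSeries.coeff_ofScalars] at h3
  exact h3

theorem aPlusNorm_eq {p : AbsSeries} {f : ℂ → ℂ} (hf : ∀ z ∈ ball (0 : ℂ) 1, f z = ev z p) :
    APlusNorm f = ‖p‖ := by
  simp only [APlusNorm, taylorCoeff_eq hf, norm_eq]

theorem eq_zero_of_ev_eq_zero {p : AbsSeries} (hp : ∀ z ∈ ball (0 : ℂ) 1, ev z p = 0) : p = 0 := by
  rw [← norm_eq_zero, ← aPlusNorm_eq (f := fun _ => 0) fun z hz => (hp z hz).symm,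
    aPlusNorm_eq (p := 0) fun z _ => by simp [ev], norm_zero]

theorem exists_not_forall_dvd {a : ℂ} (ha : ‖a‖ < 1) {h : AbsSeries}
    (hh : ∀ m : ℕ, ∃ k, h = (X - algebraMap ℂ _ a) ^ m * k) : h = 0 := by
  have hopen : ball (0 : ℂ) 1 ∈ nhds a := isOpen_ball.mem_nhds (mem_ball_zero_iff.mpr ha)
  have han : ∀ p : AbsSeries, AnalyticOnNhd ℂ (fun z => ev z p) (ball 0 1) := fun p =>
    (differentiableOn_ev p).analyticOnNhd isOpen_ball
  have htop : analyticOrderAt (fun z => ev z h) a = ⊤ := by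
    rw [ENat.eq_top_iff_forall_ge]
    intro m
    obtain ⟨k, hk⟩ := hh m
    rw [natCast_le_analyticOrderAt (han h a (mem_ball_zero_iff.mpr ha))]
    refine ⟨fun z => ev z k, han k a (mem_ball_zero_iff.mpr ha), ?_⟩
    filter_upwards [hopen] with z hz
    rw [hk, ev_pow_mul (mem_ball_zero_iff.mp hz).le, smul_eq_mul]
  rw [analyticOrderAt_eq_top] at htop
  have h0 := (han h).eqOn_zero_of_preconnected_of_eventuallyEq_zero
    (convex_ball _ _).isPreconnected (mem_ball_zero_iff.mpr ha) htop
  exact eq_zero_of_ev_eq_zero fun z hz => h0 hz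

/-- The zeros of the division ideal lie on the circle, if every inner function dividing `I`
divides `f`. -/
theorem zeros_divIdeal_subset_sphere {I : Ideal AbsSeries} (hI : I ≠ ⊥) {f : AbsSeries}
    (hf : ∀ S, IsInnerFunction S → (∀ h ∈ I, InnerDivides S fun z => ev z h) →
      InnerDivides S fun z => ev z f) :
    zeros (divIdeal I f) ⊆ sphere 0 1 := by
  rintro a ⟨ha1, ha0⟩
  rw [mem_sphere_zero_iff_norm]
  by_contra hne
  have ha : ‖a‖ < 1 := lt_of_le_of_ne ha1 hne
  classical
  have hdvd : ∀ m, (∀ j < m, ¬ ∃ h ∈ I, ∃ k, h = (X - algebraMap ℂ _ a) ^ j * k ∧ ev a k ≠ 0) →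
      ∀ h ∈ I, ∃ k, h = (X - algebraMap ℂ _ a) ^ m * k := by
    intro m
    induction m with
    | zero => exact fun _ h _ => ⟨h, by simp⟩
    | succ m ih =>
      intro hm h hh
      obtain ⟨k, hk⟩ := ih (fun j hj => hm j (hj.trans m.lt_succ_self)) h hh
      have hk0 : ev a k = 0 := by
        by_contra hcon
        exact hm m m.lt_succ_self ⟨h, hh, k, hk, hcon⟩
      obtain ⟨q, hq⟩ := exists_eq_mul_of_ev_eq_zero ha hk0
      exact ⟨q, by rw [hk, hq, pow_succ, mul_assoc]⟩
  have hex : ∃ m, ∃ h ∈ I, ∃ k, h = (X - algebraMap ℂ _ a) ^ m * k ∧ ev a k ≠ 0 := by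
    by_contra hcon
    obtain ⟨h, hh, h0⟩ := Submodule.exists_mem_ne_zero_of_ne_bot hI
    exact h0 (exists_not_forall_dvd ha fun m => hdvd m (fun j _ hj => hcon ⟨j, hj⟩) h hh)
  have hall := hdvd (Nat.find hex) fun j hj => Nat.find_min hex hj
  obtain ⟨h, hh, k, hk, hk0⟩ := Nat.find_spec hex
  generalize Nat.find hex = m at *
  obtain ⟨G, ⟨hGd, -⟩, hG⟩ := hf _ (isInnerFunction_blaschke_pow ha m) fun p hp => by
    obtain ⟨q, hq⟩ := hall p hp
    refine ⟨fun z => (1 - (starRingEnd ℂ) a * z) ^ m * ev z q, ⟨?_, 2 ^ m * ‖q‖, fun z hz => ?_⟩,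
      fun z hz => ?_⟩
    · exact DifferentiableOn.mul (by fun_prop) (differentiableOn_ev q)
    · have hz1 := (mem_ball_zero_iff.mp hz).le
      rw [norm_mul, norm_pow]
      gcongr
      · refine (norm_sub_le _ _).trans ?_
        rw [norm_one, norm_mul, RCLike.norm_conj]
        nlinarith [norm_nonneg z, norm_nonneg a]
      · exact norm_ev_le hz1 q
    · have hz1 := (mem_ball_zero_iff.mp hz).le
      have := one_sub_conj_mul_ne_zero ha hz1
      simp only [hq, ev_pow_mul hz1, div_pow]
      rw [div_mul_eq_mul_div, eq_div_iff (pow_ne_zero m this)]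
      ring
  have haball : a ∈ ball (0 : ℂ) 1 := mem_ball_zero_iff.mpr ha
  have hnhds : ball (0 : ℂ) 1 ∈ nhds a := isOpen_ball.mem_nhds haball
  have hfdvd : ∀ j ≤ m, ∃ q, f = (X - algebraMap ℂ _ a) ^ j * q := by
    intro j
    induction j with
    | zero => exact fun _ => ⟨f, by simp⟩
    | succ j ih =>
      intro hj
      obtain ⟨q, hq⟩ := ih (by omega)
      obtain ⟨l, rfl⟩ : ∃ l, m = j + 1 + l := ⟨m - (j + 1), by omega⟩
      have hcts : ContinuousAt (fun z => ev z q) a :=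
        (continuousOn_ev q).continuousAt (mem_of_superset hnhds ball_subset_closedBall)
      have hcts2 : ContinuousAt
          (fun z => (z - a) ^ (l + 1) * (G z / (1 - (starRingEnd ℂ) a * z) ^ (j + 1 + l))) a := by
        have h1 := (hGd.differentiableAt hnhds).continuousAt
        have h2 : (1 - (starRingEnd ℂ) a * a) ^ (j + 1 + l) ≠ 0 :=
          pow_ne_zero _ (one_sub_conj_mul_ne_zero ha ha.le)
        fun_prop (disch := assumption)
      have heq : (fun z => ev z q) =ᶠ[nhdsWithin a {a}ᶜ]
          (fun z => (z - a) ^ (l + 1) * (G z / (1 - (starRingEnd ℂ) a * z) ^ (j + 1 + l))) := by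
        filter_upwards [self_mem_nhdsWithin, nhdsWithin_le_nhds hnhds] with z hza hz
        have hz1 := (mem_ball_zero_iff.mp hz).le
        have h1 : z - a ≠ 0 := sub_ne_zero.mpr hza
        have h2 := one_sub_conj_mul_ne_zero ha hz1
        have h3 := hG z hz
        simp only at h3
        rw [hq, ev_pow_mul hz1, div_pow] at h3
        apply mul_left_cancel₀ (pow_ne_zero j h1)
        rw [h3]
        field_simp
        ring
      have hlim := (hcts.tendsto.mono_left nhdsWithin_le_nhds).congr' heq
      have hq0 := tendsto_nhds_unique hlim (hcts2.tendsto.mono_left nhdsWithin_le_nhds)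
      rw [sub_self, zero_pow (by omega), zero_mul] at hq0
      obtain ⟨q', hq'⟩ := exists_eq_mul_of_ev_eq_zero ha hq0
      exact ⟨q', by rw [hq, hq', pow_succ, mul_assoc]⟩
  obtain ⟨q, hq⟩ := hfdvd m le_rfl
  apply hk0
  apply ha0
  rw [mem_divIdeal]
  have : f * k = q * h := by
    rw [hk, hq]
    ring
  rw [this]
  exact I.mul_mem_left q hh

end AbsSeries

theorem re_add_div_sub {ζ z : ℂ} (hζ : ‖ζ‖ = 1) :
    ((ζ + z) / (ζ - z)).re = (1 - ‖z‖ ^ 2) / ‖ζ - z‖ ^ 2 := by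
  have h1 : ζ.re * ζ.re + ζ.im * ζ.im = 1 := by
    rw [← normSq_apply, normSq_eq_norm_sq, hζ, one_pow]
  rw [div_re, ← add_div, ← normSq_eq_norm_sq, ← normSq_eq_norm_sq, normSq_apply z]
  congr 1
  simp
  linear_combination h1

/-- The singular inner function with a point mass `c` at `ζ`. -/
def pointInner (c : ℝ) (ζ z : ℂ) : ℂ := exp (-(c * ((ζ + z) / (ζ - z))))

theorem norm_pointInner (c : ℝ) (ζ z : ℂ) :
    ‖pointInner c ζ z‖ = Real.exp (-(c * ((ζ + z) / (ζ - z)).re)) := by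
  rw [pointInner, norm_exp, neg_re, re_ofReal_mul]

theorem differentiableAt_pointInner (c : ℝ) {ζ z : ℂ} (hz : z ≠ ζ) :
    DifferentiableAt ℂ (pointInner c ζ) z := by
  have : ζ - z ≠ 0 := sub_ne_zero.mpr hz.symm
  unfold pointInner
  fun_prop (disch := assumption)

theorem ne_of_mem_ball {ζ z : ℂ} (hζ : ‖ζ‖ = 1) (hz : z ∈ ball (0 : ℂ) 1) : z ≠ ζ := by
  rintro rfl
  rw [mem_ball_zero_iff] at hz
  linarith

theorem isInnerFunction_pointInner {c : ℝ} (hc : 0 ≤ c) {ζ : ℂ} (hζ : ‖ζ‖ = 1) :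
    IsInnerFunction (pointInner c ζ) := by
  refine isInnerFunction_of_continuousAt
    (fun z hz => (differentiableAt_pointInner c (ne_of_mem_ball hζ hz)).differentiableWithinAt)
    (fun z hz => ?_) ?_
  · rw [norm_pointInner, Real.exp_le_one_iff, neg_nonpos, re_add_div_sub hζ]
    have := mem_ball_zero_iff.mp hz
    have : 0 ≤ 1 - ‖z‖ ^ 2 := by nlinarith [norm_nonneg z]
    positivity
  · have hct : {θ : ℝ | exp (θ * I) = ζ}.Countable := by
      rcases eq_empty_or_nonempty {θ : ℝ | exp (θ * I) = ζ} with h | ⟨θ₀, h₀⟩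
      · rw [h]
        exact countable_empty
      · refine (countable_range fun n : ℤ => θ₀ + n * (2 * Real.pi)).mono fun θ hθ => ?_
        obtain ⟨n, hn⟩ := exp_eq_exp_iff_exists_int.mp (Eq.trans hθ (Eq.symm h₀))
        refine ⟨n, ?_⟩
        have h1 := congrArg im hn
        simpa using h1.symm
    filter_upwards [hct.ae_notMem volume] with θ hθ
    have hθ : exp (θ * I) ≠ ζ := hθ
    refine ⟨(differentiableAt_pointInner c hθ).continuousAt, ?_⟩
    rw [norm_pointInner, re_add_div_sub hζ, norm_exp_ofReal_mul_I]
    simp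

namespace AbsSeries

theorem norm_ev_mul_exp_le_of_axis {h : AbsSeries} {ζ : ℂ} {c : ℝ} (hζ : ‖ζ‖ = 1) (hc : 0 ≤ c)
    (hx : ∀ x : ℝ, 2 ≤ x → ‖ev (ζ * (x - 1) / (x + 1)) h‖ ≤ ‖h‖ * Real.exp (-(c * x)))
    {w : ℂ} (hw : 0 ≤ w.re) : ‖ev (ζ * (w - 1) / (w + 1)) h * exp (c * w)‖ ≤ ‖h‖ := by
  have hne : ∀ w : ℂ, 0 ≤ w.re → w + 1 ≠ 0 := fun w hw h0 => by
    have := congrArg re h0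
    simp at this
    linarith
  have hle : ∀ w : ℂ, 0 ≤ w.re → ‖ζ * (w - 1) / (w + 1)‖ ≤ 1 := fun w hw => by
    have h1 := norm_cayley_sq hζ (hne w hw)
    have : 0 ≤ 4 * w.re / ‖w + 1‖ ^ 2 := by positivity
    exact (sq_le_one_iff₀ (norm_nonneg _)).mp (by linarith)
  have hlt : ∀ w : ℂ, 0 < w.re → ‖ζ * (w - 1) / (w + 1)‖ < 1 := fun w hw => by
    have h1 := norm_cayley_sq hζ (hne w hw.le)
    have h2 : 0 < ‖w + 1‖ := norm_pos_iff.mpr (hne w hw.le)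
    have : 0 < 4 * w.re / ‖w + 1‖ ^ 2 := by positivity
    exact (sq_lt_one_iff₀ (norm_nonneg _)).mp (by linarith)
  have hexp : ∀ w : ℂ, ‖exp (c * w)‖ = Real.exp (c * w.re) := fun w => by
    rw [norm_exp, re_ofReal_mul]
  refine PhragmenLindelof.right_half_plane_of_bounded_on_real
    (f := fun w => ev (ζ * (w - 1) / (w + 1)) h * exp (c * w)) ⟨?_, ?_⟩ ⟨1, by norm_num, c, ?_⟩
    ?_ ?_ hw
  · refine DifferentiableOn.mul ?_ (by fun_prop)
    refine (differentiableOn_ev h).comp (g := fun z => ev z h) (fun w hw => ?_)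
      fun w hw => mem_ball_zero_iff.mpr (hlt w hw)
    have := hne w (le_of_lt hw)
    exact DifferentiableAt.differentiableWithinAt (by fun_prop (disch := assumption))
  · rw [closure_setOfPred_lt_re]
    refine ContinuousOn.mul ?_ (by fun_prop)
    refine (continuousOn_ev h).comp (g := fun z => ev z h) (fun w hw => ?_)
      fun w hw => mem_closedBall_zero_iff.mpr (hle w hw)
    have := hne w hw
    exact ContinuousAt.continuousWithinAt (by fun_prop (disch := assumption))
  · apply Asymptotics.IsBigO.of_bound ‖h‖
    filter_upwards [mem_inf_of_right (mem_principal_self _)] with z hz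
    have hz : 0 < z.re := hz
    rw [norm_mul, hexp, Real.norm_eq_abs, Real.abs_exp, Real.rpow_one]
    gcongr
    · exact norm_ev_le (hle z hz.le) h
    · exact re_le_norm z
  · refine isBoundedUnder_of_eventually_le (a := ‖h‖) ?_
    filter_upwards [eventually_ge_atTop 2] with x h2
    rw [norm_mul, hexp, ofReal_re]
    calc _ ≤ ‖h‖ * Real.exp (-(c * x)) * Real.exp (c * x) := by
          gcongr
          exact hx x h2
      _ = ‖h‖ := by rw [mul_assoc, ← Real.exp_add, neg_add_cancel, Real.exp_zero, mul_one]
  · intro y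
    rw [norm_mul, hexp]
    simpa using norm_ev_le (hle (y * I) (by simp)) h

theorem norm_ev_le_of_axis {h : AbsSeries} {ζ : ℂ} {c : ℝ} (hζ : ‖ζ‖ = 1) (hc : 0 ≤ c)
    (hx : ∀ x : ℝ, 2 ≤ x → ‖ev (ζ * (x - 1) / (x + 1)) h‖ ≤ ‖h‖ * Real.exp (-(c * x)))
    {z : ℂ} (hz : z ∈ ball (0 : ℂ) 1) : ‖ev z h‖ ≤ ‖h‖ * ‖pointInner c ζ z‖ := by
  have hz1 := ne_of_mem_ball hζ hz
  have h1 : ζ - z ≠ 0 := sub_ne_zero.mpr hz1.symm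
  have hζ0 : ζ ≠ 0 := norm_ne_zero_iff.mp (by rw [hζ]; exact one_ne_zero)
  have hw : 0 ≤ ((ζ + z) / (ζ - z)).re := by
    rw [re_add_div_sub hζ]
    have := mem_ball_zero_iff.mp hz
    have : 0 ≤ 1 - ‖z‖ ^ 2 := by nlinarith [norm_nonneg z]
    positivity
  have h2 := norm_ev_mul_exp_le_of_axis hζ hc hx hw
  have h3 : ζ * ((ζ + z) / (ζ - z) - 1) / ((ζ + z) / (ζ - z) + 1) = z := by
    have : (ζ + z) / (ζ - z) + 1 = 2 * ζ / (ζ - z) := by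
      field_simp
      ring
    rw [this]
    field_simp
    ring
  rw [h3, norm_mul, norm_exp, re_ofReal_mul] at h2
  rw [norm_pointInner, Real.exp_neg, ← div_eq_mul_inv, le_div_iff₀ (Real.exp_pos _)]
  exact h2

/-- The largest point mass at `ζ` of the singular inner functions dividing all elements of `I`. -/
theorem exists_maximal_pointInner {I : Ideal AbsSeries} (hI : I ≠ ⊥) {ζ : ℂ} (hζ : ‖ζ‖ = 1) :
    ∃ c : ℝ, 0 ≤ c ∧ (∀ h ∈ I, ∀ z ∈ ball (0 : ℂ) 1, ‖ev z h‖ ≤ ‖h‖ * ‖pointInner c ζ z‖) ∧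
      ∀ ε > 0, ∃ h ∈ I, ∃ x : ℝ, 2 ≤ x ∧
        ‖h‖ * Real.exp (-((c + ε) * x)) < ‖ev (ζ * (x - 1) / (x + 1)) h‖ := by
  set S : Set ℝ :=
    {c | 0 ≤ c ∧ ∀ h ∈ I, ∀ z ∈ ball (0 : ℂ) 1, ‖ev z h‖ ≤ ‖h‖ * ‖pointInner c ζ z‖} with hS
  have hne : S.Nonempty := ⟨0, le_rfl, fun h _ z hz => by
    simpa [pointInner] using norm_ev_le (mem_ball_zero_iff.mp hz).le h⟩
  have hcl : IsClosed S := by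
    have : S = Ici 0 ∩
        ⋂ h ∈ I, ⋂ z ∈ ball (0 : ℂ) 1, {c | ‖ev z h‖ ≤ ‖h‖ * ‖pointInner c ζ z‖} := by
      ext c
      simp only [hS, mem_inter_iff, mem_iInter, mem_ofPred_eq, mem_Ici]
    rw [this]
    refine isClosed_Ici.inter (isClosed_biInter fun h _ => isClosed_biInter fun z _ => ?_)
    refine isClosed_le continuous_const ?_
    unfold pointInner
    fun_prop
  have hbdd : BddAbove S := by
    obtain ⟨h, hh, h0⟩ := Submodule.exists_mem_ne_zero_of_ne_bot hI
    obtain ⟨z, hz, hz0⟩ : ∃ z ∈ ball (0 : ℂ) 1, ev z h ≠ 0 := by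
      by_contra! hcon
      exact h0 (eq_zero_of_ev_eq_zero hcon)
    have hw : 0 < ((ζ + z) / (ζ - z)).re := by
      rw [re_add_div_sub hζ]
      have h1 := mem_ball_zero_iff.mp hz
      have h2 : 0 < 1 - ‖z‖ ^ 2 := by nlinarith [norm_nonneg z]
      have h3 : 0 < ‖ζ - z‖ := norm_pos_iff.mpr (sub_ne_zero.mpr (ne_of_mem_ball hζ hz).symm)
      positivity
    have hpos : 0 < ‖ev z h‖ := norm_pos_iff.mpr hz0
    have hhpos : 0 < ‖h‖ := norm_pos_iff.mpr h0
    refine ⟨-Real.log (‖ev z h‖ / ‖h‖) / ((ζ + z) / (ζ - z)).re, fun c hc => ?_⟩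
    have h1 := hc.2 h hh z hz
    rw [norm_pointInner] at h1
    rw [le_div_iff₀ hw, le_neg, Real.log_le_iff_le_exp (by positivity), div_le_iff₀ hhpos, mul_comm]
    exact h1
  have hmem := hcl.csSup_mem hne hbdd
  refine ⟨sSup S, hmem.1, hmem.2, fun ε hε => ?_⟩
  by_contra! hcon
  have hc : 0 ≤ sSup S + ε := add_nonneg hmem.1 hε.le
  have : sSup S + ε ∈ S :=
    ⟨hc, fun h hh z hz => norm_ev_le_of_axis hζ hc (hcon h hh) hz⟩
  linarith [le_csSup hbdd this]

end AbsSeries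

theorem pointInner_ne_zero (c : ℝ) (ζ z : ℂ) : pointInner c ζ z ≠ 0 := exp_ne_zero _

theorem norm_pointInner_axis (c : ℝ) {ζ : ℂ} (hζ : ‖ζ‖ = 1) {x : ℝ} (hx : 2 ≤ x) :
    ‖pointInner c ζ (ζ * (x - 1) / (x + 1))‖ = Real.exp (-(c * x)) := by
  have hζ0 : ζ ≠ 0 := norm_ne_zero_iff.mp (by rw [hζ]; exact one_ne_zero)
  have h1 : (x : ℂ) + 1 ≠ 0 := by
    norm_cast
    linarith
  have h2 : ζ - ζ * (x - 1) / (x + 1) = 2 * ζ / (x + 1) := by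
    field_simp
    ring
  have h3 : (ζ + ζ * (x - 1) / (x + 1)) / (ζ - ζ * (x - 1) / (x + 1)) = x := by
    rw [h2]
    field_simp
    ring
  rw [norm_pointInner, h3, ofReal_re]

namespace AbsSeries

variable {I : Ideal AbsSeries} {f : AbsSeries}

theorem exists_norm_ev_le_pointInner
    (hf : ∀ S, IsInnerFunction S → (∀ h ∈ I, InnerDivides S fun z => ev z h) →
      InnerDivides S fun z => ev z f) {ζ : ℂ} (hζ : ‖ζ‖ = 1) {c : ℝ} (hc : 0 ≤ c)
    (hI : ∀ h ∈ I, ∀ z ∈ ball (0 : ℂ) 1, ‖ev z h‖ ≤ ‖h‖ * ‖pointInner c ζ z‖) :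
    ∃ C : ℝ, ∀ z ∈ ball (0 : ℂ) 1, ‖ev z f‖ ≤ C * ‖pointInner c ζ z‖ := by
  obtain ⟨G, ⟨-, C, hC⟩, hG⟩ := hf _ (isInnerFunction_pointInner hc hζ) fun h hh => by
    refine ⟨fun z => ev z h / pointInner c ζ z, ⟨(differentiableOn_ev h).div (fun z hz =>
      (differentiableAt_pointInner c (ne_of_mem_ball hζ hz)).differentiableWithinAt)
      fun z _ => pointInner_ne_zero c ζ z, ‖h‖, fun z hz => ?_⟩, fun z _ => ?_⟩
    · rw [norm_div, div_le_iff₀ (norm_pos_iff.mpr (pointInner_ne_zero c ζ z))]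
      exact hI h hh z hz
    · exact (mul_div_cancel₀ _ (pointInner_ne_zero c ζ z)).symm
  refine ⟨C, fun z hz => ?_⟩
  have h1 : ev z f = _ := hG z hz
  rw [h1, norm_mul, mul_comm]
  gcongr
  exact hC z hz

variable [IsClosed (I : Set AbsSeries)] [IsClosed (divIdeal I f : Set AbsSeries)]

theorem exists_multiplier (hI : I ≠ ⊥)
    (hf : ∀ S, IsInnerFunction S → (∀ h ∈ I, InnerDivides S fun z => ev z h) →
      InnerDivides S fun z => ev z f) {ζ : ℂ} (hζ : ‖ζ‖ = 1) (φ : (AbsSeries ⧸ I) →L[ℂ] ℂ)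
    {ε : ℝ} (hε : 0 < ε) :
    ∃ (g : ℂ → ℂ) (M x₀ : ℝ), 2 ≤ x₀ ∧ DifferentiableOn ℂ g (ball 0 1) ∧
      (∀ z ∈ ball (0 : ℂ) 1, ‖g z‖ ≤ 1) ∧
      (∀ z ∈ ball (0 : ℂ) 1, ‖cauchyTransform I f φ z * g z‖ ≤ M / (1 - ‖z‖)) ∧
      Real.exp (-(ε * x₀)) ≤ ‖g (ζ * (x₀ - 1) / (x₀ + 1))‖ := by
  obtain ⟨c, hc, hdiv, hmax⟩ := exists_maximal_pointInner hI hζ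
  obtain ⟨C, hC⟩ := exists_norm_ev_le_pointInner hf hζ hc hdiv
  obtain ⟨h, hh, x, hx, hlt⟩ := hmax ε hε
  have hpos : 0 < ‖h‖ := by
    refine (norm_nonneg h).lt_of_ne fun h0 => ?_
    rw [norm_eq_zero.mp h0.symm, norm_zero, zero_mul] at hlt
    simp [ev] at hlt
  have hP : ∀ z, 0 < ‖pointInner c ζ z‖ := fun z => norm_pos_iff.mpr (pointInner_ne_zero c ζ z)
  have hn : ∀ z, ‖ev z h / (‖h‖ * pointInner c ζ z)‖ = ‖ev z h‖ / (‖h‖ * ‖pointInner c ζ z‖) :=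
    fun z => by rw [norm_div, norm_mul, norm_real, norm_norm]
  refine ⟨fun z => ev z h / (‖h‖ * pointInner c ζ z), ‖φ‖ * (C + ‖f‖), x, hx, ?_, ?_, ?_, ?_⟩
  · refine (differentiableOn_ev h).div (DifferentiableOn.const_mul (fun z hz =>
      (differentiableAt_pointInner c (ne_of_mem_ball hζ hz)).differentiableWithinAt) _)
      fun z _ => mul_ne_zero (ofReal_ne_zero.mpr hpos.ne') (pointInner_ne_zero c ζ z)
  · intro z hz
    rw [hn, div_le_one (mul_pos hpos (hP z))]
    exact hdiv h hh z hz
  · intro z hz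
    have hz1 : 0 < 1 - ‖z‖ := sub_pos.mpr (mem_ball_zero_iff.mp hz)
    have h1 := norm_cauchyTransform_mul_le (f := f) φ hh (mem_ball_zero_iff.mp hz)
    rw [norm_mul] at h1 ⊢
    rw [hn, ← mul_div_assoc, div_le_iff₀ (mul_pos hpos (hP z))]
    refine h1.trans ?_
    rw [div_mul_eq_mul_div, mul_assoc ‖φ‖]
    refine div_le_div_of_nonneg_right (mul_le_mul_of_nonneg_left ?_ φ.opNorm_nonneg) hz1.le
    have h2 := mul_le_mul_of_nonneg_right (hC z hz) hpos.le
    have h3 := mul_le_mul_of_nonneg_right (hdiv h hh z hz) (norm_nonneg f)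
    linarith
  · rw [hn, norm_pointInner_axis c hζ hx, le_div_iff₀ (mul_pos hpos (Real.exp_pos _))]
    refine le_trans (le_of_eq ?_) hlt.le
    rw [mul_left_comm, ← Real.exp_add]
    ring_nf

/-- The zero set of the division ideal has no isolated point at which `f` vanishes. -/
theorem false_of_isolated (hI : I ≠ ⊥)
    (hf : ∀ S, IsInnerFunction S → (∀ h ∈ I, InnerDivides S fun z => ev z h) →
      InnerDivides S fun z => ev z f) {ζ : ℂ} (hζ : ζ ∈ zeros (divIdeal I f)) (hfζ : ev ζ f = 0)
    {ρ : ℝ} (hρ : 0 < ρ) (hiso : ∀ z ∈ ball ζ ρ, z ∈ zeros (divIdeal I f) → z = ζ) : False := by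
  have hsub := zeros_divIdeal_subset_sphere hI hf
  have hζ1 : ‖ζ‖ = 1 := mem_sphere_zero_iff_norm.mp (hsub hζ)
  refine false_of_circleIntegral_eq_zero (half_pos hρ) hζ (fun z hz hz0 => ?_) fun φ => ?_
  · have hd : dist z ζ = ρ / 2 := hz
    rw [hiso z (mem_ball.mpr (by linarith)) hz0, dist_self] at hd
    linarith
  · have hF1 : DifferentiableOn ℂ (cauchyTransform I f φ) (ball 0 1) := fun z hz =>
      (differentiableAt_cauchyTransform φ fun h0 =>
        (mem_ball_zero_iff.mp hz).ne (mem_sphere_zero_iff_norm.mp (hsub h0))).differentiableWithinAt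
    have hF2 : DifferentiableOn ℂ (cauchyTransform I f φ) (ball ζ ρ \ {ζ}) := fun z hz =>
      (differentiableAt_cauchyTransform φ fun h0 =>
        hz.2 (hiso z hz.1 h0)).differentiableWithinAt
    have hφ := φ.opNorm_nonneg
    obtain ⟨δ, hδ, K, hK⟩ := exists_sq_mul_bound_near_point (C := ‖φ‖ * ‖f‖ + 1) hζ1 hρ
      (by positivity) hF1 hF2 (fun z hz => (norm_cauchyTransform_le φ hz).trans
        (div_le_div_of_nonneg_right (by linarith) (by linarith)))
      fun ε hε => exists_multiplier hI hf hζ1 φ hε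
    exact circleIntegral_eq_zero_of_sq_mul_bounded hζ1 hδ hF2 hK (tendsto_cauchyTransform φ hζ1 hfζ)
      (half_pos hρ) (half_lt_self hρ)

end AbsSeries

namespace AbsSeries

theorem ev_mem_aPlus (p : AbsSeries) : (fun z => ev z p) ∈ APlus :=
  ⟨p.coeff, p.summable_norm_coeff, fun _ hz => hasSum_ev (mem_closedBall_zero_iff.mp hz) p⟩

theorem exists_ev_eq {f : ℂ → ℂ} (hf : f ∈ APlus) :
    ∃ p : AbsSeries, ∀ z ∈ closedBall (0 : ℂ) 1, f z = ev z p := by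
  obtain ⟨a, ha, hs⟩ := hf
  refine ⟨ofCoeff a ha, fun z hz => ?_⟩
  have h1 := hasSum_ev (mem_closedBall_zero_iff.mp hz) (ofCoeff a ha)
  simp only [coeff_ofCoeff] at h1
  exact (hs z hz).unique h1

theorem mem_of_eqOn {I : Set (ℂ → ℂ)} (hI : IsClosedIdealAPlus I) {f g : ℂ → ℂ} (hf : f ∈ APlus)
    (hg : g ∈ I) (hfg : ∀ z ∈ closedBall (0 : ℂ) 1, f z = g z) : f ∈ I := by
  refine hI.2.2.2 f hf fun ε hε => ⟨g, hg, ?_⟩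
  rwa [aPlusNorm_eq (p := 0) fun z hz => ?_, norm_zero]
  rw [Pi.sub_apply, hfg z (ball_subset_closedBall hz), sub_self]
  simp [ev]

/-- The ideal of series whose sum belongs to `I`. -/
def idealOf (I : Set (ℂ → ℂ)) (hI : IsClosedIdealAPlus I) (hne : I.Nonempty) : Ideal AbsSeries where
  carrier := {p | (fun z => ev z p) ∈ I}
  zero_mem' := by
    obtain ⟨g, hg⟩ := hne
    refine mem_of_eqOn hI (ev_mem_aPlus 0) (hI.2.2.1 _ (ev_mem_aPlus 0) g hg) fun z _ => ?_
    simp [ev]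
  add_mem' := fun {p q} hp hq => by
    refine mem_of_eqOn hI (ev_mem_aPlus _) (hI.2.1 _ hp _ hq) fun z hz => ?_
    exact map_add (evHom (mem_closedBall_zero_iff.mp hz)) p q
  smul_mem' := fun p q hq => by
    refine mem_of_eqOn hI (ev_mem_aPlus _) (hI.2.2.1 _ (ev_mem_aPlus p) _ hq) fun z hz => ?_
    exact ev_mul (mem_closedBall_zero_iff.mp hz) p q

variable {I : Set (ℂ → ℂ)} {hI : IsClosedIdealAPlus I} {hne : I.Nonempty}

theorem mem_idealOf {p : AbsSeries} : p ∈ idealOf I hI hne ↔ (fun z => ev z p) ∈ I := Iff.rfl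

theorem mem_idealOf_of_eqOn {p : AbsSeries} {g : ℂ → ℂ} (hg : g ∈ I)
    (h : ∀ z ∈ closedBall (0 : ℂ) 1, g z = ev z p) : p ∈ idealOf I hI hne :=
  mem_idealOf.mpr (mem_of_eqOn hI (ev_mem_aPlus p) hg fun z hz => (h z hz).symm)

theorem isClosed_idealOf : IsClosed (idealOf I hI hne : Set AbsSeries) := by
  refine isClosed_of_closure_subset fun p hp => hI.2.2.2 _ (ev_mem_aPlus p) fun ε hε => ?_
  obtain ⟨q, hq, hpq⟩ := Metric.mem_closure_iff.mp hp ε hε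
  refine ⟨fun z => ev z q, hq, ?_⟩
  rwa [aPlusNorm_eq (p := p - q) fun z hz => ?_, ← dist_eq_norm]
  exact (ev_sub (mem_ball_zero_iff.mp hz).le p q).symm

theorem hull_eq_zeros : hull I = zeros (idealOf I hI hne) := by
  ext z
  refine ⟨fun ⟨hz, h⟩ => ⟨mem_closedBall_zero_iff.mp hz, fun p hp => h _ hp⟩, fun ⟨hz, h⟩ =>
    ⟨mem_closedBall_zero_iff.mpr hz, fun g hg => ?_⟩⟩
  obtain ⟨p, hp⟩ := exists_ev_eq (hI.1 hg)
  rw [hp z (mem_closedBall_zero_iff.mpr hz)]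
  exact h p (mem_idealOf_of_eqOn hg hp)

theorem hull_idiv_eq_zeros {f : ℂ → ℂ} {p : AbsSeries}
    (hp : ∀ z ∈ closedBall (0 : ℂ) 1, f z = ev z p) :
    hull (Idiv I f) = zeros (divIdeal (idealOf I hI hne) p) := by
  ext z
  refine ⟨fun ⟨hz, h⟩ => ⟨mem_closedBall_zero_iff.mp hz, fun q hq => h _ ⟨ev_mem_aPlus q, ?_⟩⟩,
    fun ⟨hz, h⟩ => ⟨mem_closedBall_zero_iff.mpr hz, fun g hg => ?_⟩⟩
  · refine mem_of_eqOn hI ?_ (mem_idealOf.mp (mem_divIdeal.mp hq)) fun w hw => ?_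
    · obtain ⟨a, ha, hs⟩ := ev_mem_aPlus (p * q)
      refine ⟨a, ha, fun w hw => ?_⟩
      rw [Pi.mul_apply, hp w hw, ← ev_mul (mem_closedBall_zero_iff.mp hw)]
      exact hs w hw
    · rw [Pi.mul_apply, hp w hw, ← ev_mul (mem_closedBall_zero_iff.mp hw)]
  · obtain ⟨q, hq⟩ := exists_ev_eq hg.1
    rw [hq z (mem_closedBall_zero_iff.mpr hz)]
    refine h q (mem_divIdeal.mpr (mem_idealOf_of_eqOn hg.2 fun w hw => ?_))
    rw [Pi.mul_apply, hp w hw, hq w hw, ev_mul (mem_closedBall_zero_iff.mp hw)]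

theorem zeros_anti {J K : Ideal AbsSeries} (h : J ≤ K) : zeros K ⊆ zeros J :=
  fun _ hz => ⟨hz.1, fun g hg => hz.2 g (h hg)⟩

theorem isClosed_zeros (J : Ideal AbsSeries) : IsClosed (zeros J) := by
  refine isClosed_of_closure_subset fun z hz => ?_
  have hsub : zeros J ⊆ closedBall 0 1 := fun w hw => mem_closedBall_zero_iff.mpr hw.1
  have hz1 : z ∈ closedBall (0 : ℂ) 1 := closure_minimal hsub isClosed_closedBall hz
  refine ⟨mem_closedBall_zero_iff.mp hz1, fun g hg => ?_⟩
  have h1 := (((continuousOn_ev g) z hz1).mono hsub).mem_closure_image hz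
  have h2 : (fun w => ev w g) '' zeros J ⊆ {0} := by
    rintro _ ⟨w, hw, rfl⟩
    exact hw.2 g hg
  exact closure_minimal h2 isClosed_singleton h1

end AbsSeries

theorem InnerDivides.trans {S T f : ℂ → ℂ} (hST : InnerDivides S T) (hTf : InnerDivides T f) :
    InnerDivides S f := by
  obtain ⟨g, ⟨hgd, C, hC⟩, hg⟩ := hST
  obtain ⟨k, ⟨hkd, D, hD⟩, hk⟩ := hTf
  refine ⟨fun z => g z * k z, ⟨hgd.mul hkd, C * D, fun z hz => ?_⟩, fun z hz => ?_⟩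
  · rw [norm_mul]
    exact mul_le_mul (hC z hz) (hD z hz) (norm_nonneg _) ((norm_nonneg _).trans (hC z hz))
  · rw [hk z hz, hg z hz, mul_assoc]

/-- For a closed ideal `I ≠ {0}` of `A⁺` and a nonzero `f ∈ A⁺ ∩ S_I·H^∞`
which vanishes on `h(I) ∩ Γ`, the hull of the division ideal `I(f)` is a perfect subset
of the unit circle. -/
theorem stmt_3 (I : Set (ℂ → ℂ)) (hI : IsClosedIdealAPlus I) (hne : NontrivialIdeal I)
    (SI : ℂ → ℂ) (hSI : IsGcdInner I SI)
    (f : ℂ → ℂ) (hf : f ∈ APlus) (hfS : InnerDivides SI f)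
    (hf0 : ∃ z ∈ Metric.ball (0 : ℂ) 1, f z ≠ 0)
    (hvan : ∀ z ∈ hull I ∩ Metric.sphere (0 : ℂ) 1, f z = 0) :
    Perfect (hull (Idiv I f)) ∧ hull (Idiv I f) ⊆ Metric.sphere (0 : ℂ) 1 := by
  obtain ⟨g₀, hg₀, z₀, hz₀, hgz⟩ := hne
  have hne : I.Nonempty := ⟨g₀, hg₀⟩
  obtain ⟨p, hp⟩ := AbsSeries.exists_ev_eq hf
  have hcl : IsClosed (AbsSeries.idealOf I hI hne : Set AbsSeries) := AbsSeries.isClosed_idealOf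
  have hcl' := AbsSeries.isClosed_divIdeal (AbsSeries.idealOf I hI hne) p
  have hbot : AbsSeries.idealOf I hI hne ≠ ⊥ := fun hbot => by
    obtain ⟨q, hq⟩ := AbsSeries.exists_ev_eq (hI.1 hg₀)
    have hmem : q ∈ AbsSeries.idealOf I hI hne := AbsSeries.mem_idealOf_of_eqOn hg₀ hq
    rw [hbot, Submodule.mem_bot] at hmem
    apply hgz
    rw [hq z₀ (ball_subset_closedBall hz₀), hmem]
    simp [AbsSeries.ev]
  have hdvd : ∀ S, IsInnerFunction S →
      (∀ h ∈ AbsSeries.idealOf I hI hne, InnerDivides S fun z => AbsSeries.ev z h) →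
      InnerDivides S fun z => AbsSeries.ev z p := fun S hS h => by
    obtain ⟨k, hk, hfk⟩ := (hSI.2.2 S hS fun g hg _ => by
      obtain ⟨q, hq⟩ := AbsSeries.exists_ev_eq (hI.1 hg)
      obtain ⟨k, hk, hgk⟩ := h q (AbsSeries.mem_idealOf_of_eqOn hg hq)
      exact ⟨k, hk, fun z hz => (hq z (ball_subset_closedBall hz)).trans (hgk z hz)⟩).trans hfS
    exact ⟨k, hk, fun z hz => (hp z (ball_subset_closedBall hz)).symm.trans (hfk z hz)⟩
  have hsub := AbsSeries.zeros_divIdeal_subset_sphere hbot hdvd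
  rw [AbsSeries.hull_idiv_eq_zeros (hI := hI) (hne := hne) hp]
  refine ⟨⟨AbsSeries.isClosed_zeros _, fun ζ hζ => ?_⟩, hsub⟩
  by_contra hacc
  rw [accPt_iff_nhds] at hacc
  push Not at hacc
  obtain ⟨U, hU, hiso⟩ := hacc
  obtain ⟨ρ, hρ, hball⟩ := Metric.mem_nhds_iff.mp hU
  have hpζ : AbsSeries.ev ζ p = 0 := by
    rw [← hp ζ (sphere_subset_closedBall (hsub hζ))]
    refine hvan ζ ⟨?_, hsub hζ⟩
    rw [AbsSeries.hull_eq_zeros (hI := hI) (hne := hne)]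
    exact AbsSeries.zeros_anti (AbsSeries.le_divIdeal _ p) hζ
  exact AbsSeries.false_of_isolated hbot hdvd hζ hpζ hρ fun z hz hz0 => hiso z ⟨hball hz, hz0⟩
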